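/- arXiv:2204.04171 — 2 statements merged into one kernel-verified Lean document; each statement's English description precedes it below -/
import Mathlib

section
/- Let 1 < p < ∞ and let W₀ : M^{3×2} → [0,+∞] be continuous as an extended-valued function and p-coercive, with W₀(A) = +∞ if and only if A¹ ∧ A² = 0, and such that for every δ > 0 there exists c_δ > 0 with W₀(A) ≤ c_δ(1 + |A|^p) whenever |A¹ ∧ A²| ≥ δ. Let Q := (0,1)² ⊂ ℝ², let A ∈ M^{3×2} with rank(A) = 2 and let i ≥ 0 be fixed. Then there exists a family {θ_{n,ℓ}}_{n,ℓ ≥ 1} ⊂ Aff_c(Q, ℝ³) such that: (i) for every ℓ ≥ 1, θ_{n,ℓ} → 0 in L^p(Q, ℝ³) as n → ∞; (ii) for every n, ℓ ≥ 1 the map x ↦ Ax + θ_{n,ℓ}(x) belongs to Aff*(Q, ℝ³); (iii) limsup_{ℓ→∞} limsup_{n→∞} ∫_Q R_iW₀(A + ∇θ_{n,ℓ}(x)) dx ≤ R_{i+1}W₀(A), where ∇θ_{n,ℓ} denotes the a.e. defined gradient. -/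
open Filter MeasureTheory Set
open scoped ENNReal

noncomputable section

/-- `v` is piecewise affine on `U`: continuous on `U` and affine on each element of a finite
family of pairwise disjoint open subsets of `U` covering `U` up to a Lebesgue-null set. -/
def PiecewiseAffineOn {E F : Type*} [NormedAddCommGroup E] [NormedSpace ℝ E]
    [MeasureSpace E] [NormedAddCommGroup F] [NormedSpace ℝ F]
    (v : E → F) (U : Set E) : Prop :=
  ContinuousOn v U ∧
  ∃ (N : ℕ) (V : Fin N → Set E),
    (∀ i, IsOpen (V i)) ∧ (∀ i, V i ⊆ U) ∧
    (∀ i j, i ≠ j → Disjoint (V i) (V j)) ∧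
    volume (U \ ⋃ i, V i) = 0 ∧
    ∀ i, ∃ (L : E →L[ℝ] F) (c : F), ∀ x ∈ V i, v x = L x + c

/-- The Clarke subdifferential of `f` at `x`: the convex hull of all limits of derivatives
`fderiv ℝ f xₖ` along sequences `xₖ → x` of points of differentiability. -/
def clarkeSubdiff {E F : Type*} [NormedAddCommGroup E] [NormedSpace ℝ E]
    [NormedAddCommGroup F] [NormedSpace ℝ F] (f : E → F) (x : E) : Set (E →L[ℝ] F) :=
  convexHull ℝ {A | ∃ u : ℕ → E, Tendsto u atTop (nhds x) ∧
    (∀ k, DifferentiableAt ℝ f (u k)) ∧ Tendsto (fun k => fderiv ℝ f (u k)) atTop (nhds A)}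

/-- The matrix of a continuous linear map. -/
def clmMat {n m : ℕ} (A : EuclideanSpace ℝ (Fin n) →L[ℝ] (Fin m → ℝ)) :
    Matrix (Fin m) (Fin n) ℝ :=
  Matrix.of fun i j => A (EuclideanSpace.single j 1) i

/-- The Jacobian matrix of `f` at `x` (junk value where `f` is not differentiable). -/
def jacMat {n m : ℕ} (f : EuclideanSpace ℝ (Fin n) → (Fin m → ℝ)) (x : EuclideanSpace ℝ (Fin n)) :
    Matrix (Fin m) (Fin n) ℝ := clmMat (fderiv ℝ f x)

/-- Frobenius norm of a matrix. -/
noncomputable def mnorm {k l : ℕ} (A : Matrix (Fin k) (Fin l) ℝ) : ℝ :=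
  Real.sqrt (∑ i, ∑ j, A i j ^ 2)

/-- Euclidean norm of a vector given as a plain function. -/
noncomputable def vnorm {k : ℕ} (x : Fin k → ℝ) : ℝ :=
  Real.sqrt (∑ i, x i ^ 2)

/-- `D` is an open set which, near each boundary point and in suitable orthonormal
coordinates, coincides locally with the region strictly above the graph of a
Lipschitz function. -/
def IsLipschitzGraphDomain {m : ℕ} (D : Set (EuclideanSpace ℝ (Fin (m+1)))) : Prop :=
  IsOpen D ∧ ∀ z ∈ frontier D,
    ∃ (b : OrthonormalBasis (Fin (m+1)) ℝ (EuclideanSpace ℝ (Fin (m+1))))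
      (K : NNReal) (f : (Fin m → ℝ) → ℝ) (r : ℝ), 0 < r ∧ LipschitzWith K f ∧
      ∀ x ∈ Metric.ball z r,
        (x ∈ D ↔ f (fun i => b.repr x i.castSucc) < b.repr x (Fin.last m))

/-- `Aff*`: piecewise affine maps with maximal-rank constraint: for `n < m`, the Clarke
subgradients `A` satisfy `det (Aᵀ A) ≥ η > 0` uniformly; for `n = m`, `det ∇v > 0` a.e. -/
def AffStar {n m : ℕ} (v : EuclideanSpace ℝ (Fin n) → (Fin m → ℝ))
    (Ω : Set (EuclideanSpace ℝ (Fin n))) : Prop :=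
  PiecewiseAffineOn v Ω ∧
  ((n < m ∧ ∃ η > (0:ℝ), ∀ x ∈ Ω, ∀ A ∈ clarkeSubdiff v x,
      η ≤ ((clmMat A).transpose * clmMat A).det) ∨
   (∃ h : n = m, ∀ᵐ x ∂(volume.restrict Ω), DifferentiableAt ℝ v x ∧
      0 < ((jacMat v x).submatrix (finCongr h) id).det))

/-- Cross product in ℝ³. -/
def cross3 (u v : Fin 3 → ℝ) : Fin 3 → ℝ :=
  ![u 1 * v 2 - u 2 * v 1, u 2 * v 0 - u 0 * v 2, u 0 * v 1 - u 1 * v 0]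

/-- The 3×3 matrix `(A|ζ)` whose first two columns are those of `A` and last column is `ζ`. -/
def aug (A : Matrix (Fin 3) (Fin 2) ℝ) (ζ : Fin 3 → ℝ) : Matrix (Fin 3) (Fin 3) ℝ :=
  Matrix.of fun i j => if h : (j : ℕ) < 2 then A i ⟨j, h⟩ else ζ i

/-- The cross product `A¹ ∧ A²` of the two columns of `A`. -/
def crossCols (A : Matrix (Fin 3) (Fin 2) ℝ) : Fin 3 → ℝ :=
  cross3 (fun i => A i 0) (fun i => A i 1)

/-- The reduced energy density `W₀(A) := inf_ζ W(A|ζ)`. -/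
noncomputable def W0fun (W : Matrix (Fin 3) (Fin 3) ℝ → ℝ≥0∞) :
    Matrix (Fin 3) (Fin 2) ℝ → ℝ≥0∞ :=
  fun A => ⨅ ζ : Fin 3 → ℝ, W (aug A ζ)

/-- Rank-one convexity for extended-valued functions on 3×2 matrices. -/
def RankOneConvexENN (f : Matrix (Fin 3) (Fin 2) ℝ → ℝ≥0∞) : Prop :=
  ∀ (ξ ξ' : Matrix (Fin 3) (Fin 2) ℝ) (lam : ℝ), lam ∈ Set.Ioo (0:ℝ) 1 →
    (ξ - ξ').rank = 1 →
    f (lam • ξ + (1 - lam) • ξ') ≤ ENNReal.ofReal lam * f ξ + ENNReal.ofReal (1 - lam) * f ξ'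

/-- The rank-one convex envelope: the greatest rank-one convex function below `f`,
realized as the pointwise supremum of all rank-one convex functions below `f`. -/
noncomputable def rankOneEnv (f : Matrix (Fin 3) (Fin 2) ℝ → ℝ≥0∞) :
    Matrix (Fin 3) (Fin 2) ℝ → ℝ≥0∞ :=
  fun A => ⨆ g ∈ {g : Matrix (Fin 3) (Fin 2) ℝ → ℝ≥0∞ |
    RankOneConvexENN g ∧ ∀ B, g B ≤ f B}, g A

/-- The Kohn–Strang iterative scheme for the rank-one convex envelope. -/
noncomputable def RIter (f : Matrix (Fin 3) (Fin 2) ℝ → ℝ≥0∞) :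
    ℕ → Matrix (Fin 3) (Fin 2) ℝ → ℝ≥0∞
  | 0 => f
  | (i+1) => fun A =>
      ⨅ (a : Fin 2 → ℝ) (b : Fin 3 → ℝ) (lam : ℝ) (_ : lam ∈ Set.Icc (0:ℝ) 1),
        ENNReal.ofReal (1 - lam) * RIter f i (A - lam • Matrix.vecMulVec b a) +
        ENNReal.ofReal lam * RIter f i (A + (1 - lam) • Matrix.vecMulVec b a)


local notation "E2" => EuclideanSpace ℝ (Fin 2)

/-- The linear form with coefficients `c`. -/
def linF (c : Fin 2 → ℝ) : E2 →L[ℝ] ℝ := ∑ j, c j • (EuclideanSpace.proj j : E2 →L[ℝ] ℝ)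

theorem linF_apply (c : Fin 2 → ℝ) (x : E2) : linF c x = c 0 * x 0 + c 1 * x 1 := by
  simp [linF, Fin.sum_univ_two]

theorem linF_inj {c d : Fin 2 → ℝ} (h : linF c = linF d) : c = d := by
  funext j
  have := congrArg (fun L : E2 →L[ℝ] ℝ => L (EuclideanSpace.single j 1)) h
  fin_cases j <;> simpa [linF_apply] using this

theorem null_eq (q q' : (Fin 2 → ℝ) × ℝ) (h : q ≠ q') :
    volume {x : E2 | linF q.1 x + q.2 = linF q'.1 x + q'.2} = 0 := by
  by_cases hc : q.1 = q'.1
  · have : {x : E2 | linF q.1 x + q.2 = linF q'.1 x + q'.2} = ∅ := by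
      ext x
      simp only [Set.mem_ofPred_eq, Set.mem_empty_iff_false, iff_false, hc]
      intro h2
      exact h (Prod.ext hc (by linarith))
    rw [this]; simp
  · have hL : linF q.1 - linF q'.1 ≠ 0 := fun h0 => hc (linF_inj (sub_eq_zero.1 h0))
    obtain ⟨y, hy⟩ : ∃ y, (linF q.1 - linF q'.1) y ≠ 0 := by
      by_contra! hh
      exact hL (ContinuousLinearMap.ext hh)
    let S : AffineSubspace ℝ E2 :=
      { carrier := {x : E2 | linF q.1 x + q.2 = linF q'.1 x + q'.2}
        smul_vsub_vadd_mem' := by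
          intro c p1 p2 p3 h1 h2 h3
          simp only [Set.mem_ofPred_eq, vsub_eq_sub, vadd_eq_add, map_add, map_smul, map_sub,
            smul_eq_mul] at *
          linear_combination c * (h1 - h2) + h3 }
    have := Measure.addHaar_affineSubspace (volume : Measure E2) S (by
      intro htop
      have h0 : (0 : E2) ∈ S := htop ▸ AffineSubspace.mem_top ℝ E2 _
      have h1 : y ∈ S := htop ▸ AffineSubspace.mem_top ℝ E2 _
      change linF q.1 0 + q.2 = linF q'.1 0 + q'.2 at h0
      change linF q.1 y + q.2 = linF q'.1 y + q'.2 at h1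
      apply hy
      simp only [map_zero] at h0
      simp only [sub_apply]
      linarith)
    exact this

/-- The pieces of a continuous selection. -/
def pieceV (φ : E2 → ℝ) (U : Set E2) (S : Finset ((Fin 2 → ℝ) × ℝ)) (q : (Fin 2 → ℝ) × ℝ) : Set E2 :=
  {x | x ∈ U ∧ φ x = linF q.1 x + q.2 ∧ ∀ q' ∈ S, q' ≠ q → φ x ≠ linF q'.1 x + q'.2}

theorem pieceV_open (φ : E2 → ℝ) (hφ : Continuous φ) (U : Set E2) (hU : IsOpen U)
    (S : Finset ((Fin 2 → ℝ) × ℝ))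
    (hS : ∀ x ∈ U, ∃ q ∈ S, φ x = linF q.1 x + q.2) (q : (Fin 2 → ℝ) × ℝ) (_hq : q ∈ S) :
    IsOpen (pieceV φ U S q) := by
  have : pieceV φ U S q = U ∩ ⋂ q' ∈ S, {x | q' ≠ q → φ x ≠ linF q'.1 x + q'.2} := by
    ext x
    simp only [pieceV, Set.mem_ofPred_eq, Set.mem_inter_iff, Set.mem_iInter]
    constructor
    · rintro ⟨h1, h2, h3⟩; exact ⟨h1, h3⟩
    · rintro ⟨h1, h3⟩
      refine ⟨h1, ?_, h3⟩
      obtain ⟨r, hr, hr2⟩ := hS x h1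
      by_cases hrq : r = q
      · rw [← hrq]; exact hr2
      · exact absurd hr2 (h3 r hr hrq)
  rw [this]
  refine hU.inter (isOpen_biInter_finset fun q' _ => ?_)
  by_cases hh : q' = q
  · simp [hh]
  · simp only [ne_eq, hh, not_false_eq_true, forall_const]
    exact isOpen_ne_fun hφ (by fun_prop)

theorem pieceV_cover (φ : E2 → ℝ) (U : Set E2) (S : Finset ((Fin 2 → ℝ) × ℝ))
    (hS : ∀ x ∈ U, ∃ q ∈ S, φ x = linF q.1 x + q.2) :
    volume (U \ ⋃ q ∈ S, pieceV φ U S q) = 0 := by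
  have hnull : volume (⋃ q ∈ S, ⋃ q' ∈ S, {x : E2 | q ≠ q' ∧
      linF q.1 x + q.2 = linF q'.1 x + q'.2}) = 0 := by
    refine (measure_biUnion_null_iff S.countable_toSet).2 fun q _ =>
      (measure_biUnion_null_iff S.countable_toSet).2 fun q' _ => ?_
    by_cases h : q = q'
    · simp [h]
    · simpa [h] using null_eq q q' h
  refine measure_mono_null ?_ hnull
  rintro x ⟨hx, hx2⟩
  obtain ⟨q, hq, hqx⟩ := hS x hx
  simp only [Set.mem_iUnion, not_exists] at hx2
  have h1 := hx2 q hq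
  simp only [pieceV, Set.mem_ofPred_eq, not_and] at h1
  have h2 := h1 hx hqx
  push Not at h2
  obtain ⟨q', hq', hne, he⟩ := h2
  simp only [Set.mem_iUnion]
  exact ⟨q, hq, q', hq', fun h => hne h.symm, by rw [← hqx, he]⟩

theorem pieceV_hasFDerivAt (φ : E2 → ℝ) (U : Set E2) (S : Finset ((Fin 2 → ℝ) × ℝ))
    (q : (Fin 2 → ℝ) × ℝ) (ho : IsOpen (pieceV φ U S q)) (x : E2) (hx : x ∈ pieceV φ U S q) :
    HasFDerivAt φ (linF q.1) x := by
  have h1 : HasFDerivAt (fun y => linF q.1 y + q.2) (linF q.1) x :=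
    (linF q.1).hasFDerivAt.add_const _
  refine h1.congr_of_eventuallyEq ?_
  filter_upwards [ho.mem_nhds hx] with y hy using hy.2.1

theorem sel_ae (φ : E2 → ℝ) (hφ : Continuous φ) (U : Set E2) (hU : IsOpen U)
    (S : Finset ((Fin 2 → ℝ) × ℝ))
    (hS : ∀ x ∈ U, ∃ q ∈ S, φ x = linF q.1 x + q.2) :
    ∀ᵐ x ∂(volume.restrict U), x ∈ U ∧ ∃ q ∈ S, HasFDerivAt φ (linF q.1) x ∧
      ∀ q' ∈ S, φ x = linF q'.1 x + q'.2 → q' = q := by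
  rw [ae_restrict_iff' hU.measurableSet]
  have h := pieceV_cover φ U S hS
  rw [measure_eq_zero_iff_ae_notMem] at h
  filter_upwards [h] with x hx hxU
  simp only [Set.mem_sdiff, hxU, true_and, not_not, Set.mem_iUnion] at hx
  obtain ⟨q, hq, hqx⟩ := hx
  refine ⟨hxU, q, hq, pieceV_hasFDerivAt φ U S q (pieceV_open φ hφ U hU S hS q hq) x hqx, ?_⟩
  intro q' hq' he
  by_contra hne
  exact hqx.2.2 q' hq' hne he

theorem sel_pwa {F : Type*} [NormedAddCommGroup F] [NormedSpace ℝ F]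
    (φ : E2 → ℝ) (hφ : Continuous φ) (U : Set E2) (hU : IsOpen U)
    (S : Finset ((Fin 2 → ℝ) × ℝ))
    (hS : ∀ x ∈ U, ∃ q ∈ S, φ x = linF q.1 x + q.2) (M : E2 →L[ℝ] F) (b : F) :
    PiecewiseAffineOn (fun x => M x + φ x • b) U := by
  refine ⟨by fun_prop, S.card, fun k => pieceV φ U S (S.equivFin.symm k), ?_, ?_, ?_, ?_, ?_⟩
  · intro k
    exact pieceV_open φ hφ U hU S hS _ (S.equivFin.symm k).2
  · intro k x hx; exact hx.1
  · intro k l hkl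
    rw [Set.disjoint_left]
    intro x hx hx'
    refine hx.2.2 _ (S.equivFin.symm l).2 ?_ hx'.2.1
    intro h
    exact hkl (S.equivFin.symm.injective (Subtype.ext h.symm))
  · have : (⋃ k, pieceV φ U S (S.equivFin.symm k)) = ⋃ q ∈ S, pieceV φ U S q := by
      ext x
      simp only [Set.mem_iUnion]
      constructor
      · rintro ⟨k, hk⟩; exact ⟨_, (S.equivFin.symm k).2, hk⟩
      · rintro ⟨q, hq, hx⟩
        exact ⟨S.equivFin ⟨q, hq⟩, by simpa using hx⟩
    rw [this]; exact pieceV_cover φ U S hS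
  · intro k
    refine ⟨M + (linF (S.equivFin.symm k : (Fin 2 → ℝ) × ℝ).1).smulRight b,
      (S.equivFin.symm k : (Fin 2 → ℝ) × ℝ).2 • b, fun x hx => ?_⟩
    simp only [hx.2.1, add_apply, ContinuousLinearMap.smulRight_apply,
      add_smul, add_assoc]

/-- The linear map with matrix `A`. -/
def matL (A : Matrix (Fin 3) (Fin 2) ℝ) : E2 →L[ℝ] (Fin 3 → ℝ) :=
  ContinuousLinearMap.pi fun i => linF (A i)

theorem matL_apply (A : Matrix (Fin 3) (Fin 2) ℝ) (x : E2) (i : Fin 3) :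
    matL A x i = ∑ j, A i j * x j := by
  simp [matL, linF_apply, Fin.sum_univ_two]

theorem clmMat_matL (A : Matrix (Fin 3) (Fin 2) ℝ) (c : Fin 2 → ℝ) (b : Fin 3 → ℝ) :
    clmMat (matL A + (linF c).smulRight b) = A + Matrix.vecMulVec b c := by
  ext i j
  fin_cases j <;> simp [clmMat, matL, linF_apply, Matrix.vecMulVec_apply, mul_comm]

theorem jacMat_smul (φ : E2 → ℝ) (b : Fin 3 → ℝ) (c : Fin 2 → ℝ) (x : E2)
    (h : HasFDerivAt φ (linF c) x) : jacMat (fun y => φ y • b) x = Matrix.vecMulVec b c := by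
  have h2 : HasFDerivAt (fun y => φ y • b) ((linF c).smulRight b) x := h.smul_const b
  rw [jacMat, h2.fderiv]
  ext i j
  fin_cases j <;> simp [clmMat, linF_apply, Matrix.vecMulVec_apply, mul_comm]

theorem exists_linF (L : E2 →L[ℝ] ℝ) : ∃ c, L = linF c := by
  refine ⟨fun j => L (EuclideanSpace.single j 1), ?_⟩
  ext x
  have hx : x = x 0 • EuclideanSpace.single 0 1 + x 1 • EuclideanSpace.single 1 1 := by
    ext j; fin_cases j <;> simp
  conv_lhs => rw [hx]
  simp only [map_add, map_smul, smul_eq_mul, linF_apply]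
  ring

theorem cross_dot (A : Matrix (Fin 3) (Fin 2) ℝ) (c : Fin 2 → ℝ) (b : Fin 3 → ℝ) :
    b ⬝ᵥ crossCols (A + Matrix.vecMulVec b c) = b ⬝ᵥ crossCols A := by
  simp [dotProduct, Fin.sum_univ_three, crossCols, cross3, Matrix.vecMulVec_apply]
  ring

theorem det_ge (B : Matrix (Fin 3) (Fin 2) ℝ) (b : Fin 3 → ℝ) :
    (b ⬝ᵥ crossCols B) ^ 2 ≤ (b ⬝ᵥ b) * (B.transpose * B).det := by
  have : (b ⬝ᵥ b) * (B.transpose * B).det = (b ⬝ᵥ b) * (crossCols B ⬝ᵥ crossCols B) := by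
    simp [dotProduct, Fin.sum_univ_three, crossCols, cross3, Matrix.det_fin_two, Matrix.mul_apply]
    left
    ring
  rw [this]
  generalize crossCols B = w
  simp only [dotProduct, Fin.sum_univ_three]
  nlinarith [sq_nonneg (b 0 * w 1 - b 1 * w 0), sq_nonneg (b 0 * w 2 - b 2 * w 0),
    sq_nonneg (b 1 * w 2 - b 2 * w 1)]

theorem clarke_sub (A : Matrix (Fin 3) (Fin 2) ℝ) (b : Fin 3 → ℝ) (hb : b ≠ 0) (φ : E2 → ℝ)
    (x : E2) (B : E2 →L[ℝ] (Fin 3 → ℝ)) (hB : B ∈ clarkeSubdiff (fun y => matL A y + φ y • b) x) :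
    ∃ c, B = matL A + (linF c).smulRight b := by
  obtain ⟨k, hk⟩ : ∃ k, b k ≠ 0 := by
    by_contra! h; exact hb (funext h)
  let ρ : (Fin 3 → ℝ) →L[ℝ] ℝ := (b k)⁻¹ • ContinuousLinearMap.proj k
  have hρ : ρ b = 1 := by simp [ρ, hk]
  let T : Set (E2 →L[ℝ] (Fin 3 → ℝ)) :=
    {L | L = matL A + (ρ.comp (L - matL A)).smulRight b}
  have hT : ∀ c : E2 →L[ℝ] ℝ, matL A + c.smulRight b ∈ T := by
    intro c
    change _ = _
    congr 2
    ext y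
    simp [hρ]
  have hconv : Convex ℝ T := by
    intro L hL L' hL' s t hs ht hst
    have e : s • L + t • L' = matL A + (s • (ρ.comp (L - matL A)) +
        t • (ρ.comp (L' - matL A))).smulRight b := by
      change L = _ at hL
      change L' = _ at hL'
      conv_lhs => rw [hL, hL']
      ext y j
      simp
      linear_combination (matL A y j) * hst
    rw [e]; exact hT _
  have hclosed : IsClosed T := by
    refine isClosed_eq continuous_id ?_
    have : Continuous fun L : E2 →L[ℝ] (Fin 3 → ℝ) => (ρ.comp (L - matL A)).smulRight b := by
      have h1 : Continuous fun c : E2 →L[ℝ] ℝ => c.smulRight b :=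
        ((ContinuousLinearMap.smulRightL ℝ E2 (Fin 3 → ℝ)).flip b).continuous
      refine h1.comp ?_
      fun_prop
    fun_prop
  have hsub : clarkeSubdiff (fun y => matL A y + φ y • b) x ⊆ T := by
    refine convexHull_min ?_ hconv
    rintro L ⟨u, -, hd, hlim⟩
    refine hclosed.mem_of_tendsto hlim (Eventually.of_forall fun m => ?_)
    have h1 : DifferentiableAt ℝ (fun y => φ y • b) (u m) := by
      have := (hd m).sub (matL A).differentiableAt
      refine this.congr_of_eventuallyEq (Eventually.of_forall fun y => ?_)
      simp
    have h2 : DifferentiableAt ℝ φ (u m) := by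
      have := ρ.differentiableAt.comp (u m) h1
      refine this.congr_of_eventuallyEq (Eventually.of_forall fun y => ?_)
      simp only [Function.comp, map_smul, hρ, smul_eq_mul, mul_one]
    have h3 : HasFDerivAt (fun y => matL A y + φ y • b) (matL A + (fderiv ℝ φ (u m)).smulRight b)
        (u m) := (matL A).hasFDerivAt.add (h2.hasFDerivAt.smul_const b)
    rw [h3.fderiv]; exact hT _
  have hB2 : B = _ := hsub hB
  obtain ⟨c, hc⟩ := exists_linF (ρ.comp (B - matL A))
  exact ⟨c, by rw [← hc]; exact hB2⟩

theorem affStar_of (A : Matrix (Fin 3) (Fin 2) ℝ) (b : Fin 3 → ℝ) (hb : b ⬝ᵥ crossCols A ≠ 0)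
    (φ : E2 → ℝ) (hφ : Continuous φ) (U : Set E2) (hU : IsOpen U)
    (S : Finset ((Fin 2 → ℝ) × ℝ))
    (hS : ∀ x ∈ U, ∃ q ∈ S, φ x = linF q.1 x + q.2) :
    AffStar (fun x => matL A x + φ x • b) U := by
  have hb0 : b ≠ 0 := by rintro rfl; simp at hb
  have hbb : 0 < b ⬝ᵥ b := by
    have := Matrix.dotProduct_star_self_pos_iff (v := b)
    simpa using this.2 hb0
  refine ⟨sel_pwa φ hφ U hU S hS _ _, Or.inl ⟨by norm_num, (b ⬝ᵥ crossCols A) ^ 2 / (b ⬝ᵥ b),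
    by positivity, ?_⟩⟩
  intro x _ B hB
  obtain ⟨c, rfl⟩ := clarke_sub A b hb0 φ x B hB
  rw [clmMat_matL, div_le_iff₀ hbb, mul_comm _ (b ⬝ᵥ b), ← cross_dot A c b]
  exact det_ge _ _

theorem crossCols_ne (A : Matrix (Fin 3) (Fin 2) ℝ) (hA : A.rank = 2) : crossCols A ≠ 0 := by
  intro h
  have hli : LinearIndependent ℝ A.col := by
    rw [linearIndependent_iff_card_eq_finrank_span, Set.finrank, ← A.rank_eq_finrank_span_cols, hA]
    rfl
  have hinj := Matrix.mulVec_injective_iff.2 hli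
  have h0 := congrFun h 0
  have h1 := congrFun h 1
  have h2 := congrFun h 2
  simp [crossCols, cross3] at h0 h1 h2
  have key : ∀ i, A i = 0 := by
    intro i
    have : A.mulVec ![A i 1, - A i 0] = A.mulVec 0 := by
      ext j
      simp only [Matrix.mulVec, dotProduct, Fin.sum_univ_two]
      fin_cases i <;> fin_cases j <;> simp <;> linarith
    have := hinj this
    have e0 := congrFun this 0
    have e1 := congrFun this 1
    simp at e0 e1
    ext j; fin_cases j <;> simp [e0, e1]
  have hz : A = 0 := by ext i j; rw [key i]; rfl
  rw [hz] at hA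
  simp at hA

theorem RIter_succ_le (f : Matrix (Fin 3) (Fin 2) ℝ → ℝ≥0∞) (i : ℕ) (A) :
    RIter f (i+1) A ≤ RIter f i A := by
  have : RIter f (i+1) A ≤ ENNReal.ofReal (1 - 0) *
      RIter f i (A - (0:ℝ) • Matrix.vecMulVec (0 : Fin 3 → ℝ) (0 : Fin 2 → ℝ)) +
        ENNReal.ofReal 0 * RIter f i (A + (1 - 0 : ℝ) • Matrix.vecMulVec 0 0) :=
    iInf_le_of_le 0 (iInf_le_of_le 0 (iInf_le_of_le 0 (iInf_le_of_le (by simp) le_rfl)))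
  simpa using this

theorem RIter_le (f : Matrix (Fin 3) (Fin 2) ℝ → ℝ≥0∞) (i : ℕ) (A) :
    RIter f i A ≤ f A := by
  induction i with
  | zero => exact le_rfl
  | succ k ih => exact (RIter_succ_le f k A).trans ih

theorem usc_pair (g : Matrix (Fin 3) (Fin 2) ℝ → ℝ≥0∞) (hg : UpperSemicontinuous g) {X : Type*}
    [TopologicalSpace X] (u v : X → Matrix (Fin 3) (Fin 2) ℝ) (hu : Continuous u)
    (hv : Continuous v) (s t : ℝ) :
    UpperSemicontinuous fun x => ENNReal.ofReal s * g (u x) + ENNReal.ofReal t * g (v x) := by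
  refine UpperSemicontinuous.add ?_ ?_
  · exact (ENNReal.continuous_const_mul ENNReal.ofReal_ne_top).comp_upperSemicontinuous
      (hg.comp hu) (fun _ _ h => mul_le_mul_right h _)
  · exact (ENNReal.continuous_const_mul ENNReal.ofReal_ne_top).comp_upperSemicontinuous
      (hg.comp hv) (fun _ _ h => mul_le_mul_right h _)

theorem RIter_usc (f : Matrix (Fin 3) (Fin 2) ℝ → ℝ≥0∞) (hf : Continuous f) (i : ℕ) :
    UpperSemicontinuous (RIter f i) := by
  induction i with
  | zero => exact hf.upperSemicontinuous
  | succ k ih =>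
    refine upperSemicontinuous_iInf fun a => upperSemicontinuous_iInf fun b =>
      upperSemicontinuous_iInf fun lam => upperSemicontinuous_iInf fun _ => ?_
    exact usc_pair _ ih _ _ (by fun_prop) (by fun_prop) _ _

/-- The open unit square. -/
def Qs : Set E2 := {x : EuclideanSpace ℝ (Fin 2) | ∀ j, x j ∈ Set.Ioo (0:ℝ) 1}

theorem Qs_open : IsOpen Qs := by
  have : Qs = ⋂ j : Fin 2, {x : E2 | x j ∈ Set.Ioo (0:ℝ) 1} := by
    ext x; simp [Qs]
  rw [this]
  refine isOpen_iInter_of_finite fun j => ?_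
  exact isOpen_Ioo.preimage (by fun_prop : Continuous fun x : E2 => x j)

theorem Qs_vol : volume Qs = 1 := by
  have h := (PiLp.volume_preserving_ofLp (Fin 2)).measure_preimage
    (s := Set.pi Set.univ fun _ => Set.Ioo (0:ℝ) 1)
    (MeasurableSet.univ_pi fun _ => measurableSet_Ioo).nullMeasurableSet
  have e : (WithLp.ofLp ⁻¹' (Set.pi Set.univ fun _ => Set.Ioo (0:ℝ) 1) : Set E2) = Qs := by
    ext x; simp [Qs]
  rw [e] at h
  rw [h, Real.volume_pi_Ioo]
  simp

/-- Two-valued periodic function. -/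
def sawF (lam : ℝ) (g1 g2 : ℝ≥0∞) (t : ℝ) : ℝ≥0∞ := if Int.fract t ≤ lam then g2 else g1

theorem sawF_meas (lam : ℝ) (g1 g2 : ℝ≥0∞) : Measurable (sawF lam g1 g2) :=
  Measurable.ite (measurableSet_le measurable_fract measurable_const) measurable_const
    measurable_const

theorem sawF_int (lam : ℝ) (hl : lam ∈ Set.Icc (0:ℝ) 1) (g1 g2 : ℝ≥0∞) :
    ∫⁻ s in Set.Ioc (0:ℝ) 1, sawF lam g1 g2 s =
      ENNReal.ofReal (1 - lam) * g1 + ENNReal.ofReal lam * g2 := by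
  rw [← Set.Ioc_union_Ioc_eq_Ioc hl.1 hl.2, lintegral_union measurableSet_Ioc (by
    rw [Set.disjoint_left]; intro x hx hx'; exact absurd hx.2 (not_le.2 hx'.1)), add_comm]
  rw [← restrict_Ioo_eq_restrict_Ioc, ← restrict_Ioo_eq_restrict_Ioc]
  congr 1
  · rw [setLIntegral_congr_fun (g := fun _ => g1) measurableSet_Ioo, setLIntegral_const,
      Real.volume_Ioo, mul_comm]
    intro x hx
    have : Int.fract x = x := Int.fract_eq_self.2 ⟨hl.1.trans hx.1.le, hx.2⟩
    simp [sawF, this, hx.1]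
  · rw [setLIntegral_congr_fun (g := fun _ => g2) measurableSet_Ioo, setLIntegral_const,
      Real.volume_Ioo, mul_comm, sub_zero]
    intro x hx
    have : Int.fract x = x := Int.fract_eq_self.2 ⟨hx.1.le, hx.2.trans_le hl.2⟩
    simp [sawF, this, hx.2.le]

theorem sawF_avg (lam : ℝ) (hl : lam ∈ Set.Icc (0:ℝ) 1) (g1 g2 : ℝ≥0∞) (t : ℝ) :
    ∫⁻ s in Set.Ioc (0:ℝ) 1, sawF lam g1 g2 (t + s) =
      ENNReal.ofReal (1 - lam) * g1 + ENNReal.ofReal lam * g2 := by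
  rw [← sawF_int lam hl g1 g2]
  have h1 := (measurePreserving_add_left (volume : Measure ℝ) t).setLIntegral_comp_emb
    (measurableEmbedding_addLeft t) (sawF lam g1 g2) (Set.Ioc 0 1)
  rw [h1, Set.image_const_add_Ioc, add_zero]
  have h0 := isAddFundamentalDomain_Ioc one_pos (0:ℝ)
  rw [zero_add] at h0
  refine (isAddFundamentalDomain_Ioc one_pos t).setLIntegral_eq h0 _ ?_
  rintro ⟨g, hg⟩ x
  obtain ⟨m, rfl⟩ := AddSubgroup.mem_zmultiples_iff.1 hg
  simp [sawF, AddSubgroup.vadd_def]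

theorem exists_shift (lam : ℝ) (hl : lam ∈ Set.Icc (0:ℝ) 1) (g1 g2 : ℝ≥0∞) (u : E2 → ℝ)
    (hu : Continuous u) :
    ∃ s : ℝ, ∫⁻ x in Qs, sawF lam g1 g2 (u x + s) ≤
      ENNReal.ofReal (1 - lam) * g1 + ENNReal.ofReal lam * g2 := by
  have hm : Measurable (fun z : ℝ × E2 => sawF lam g1 g2 (u z.2 + z.1)) :=
    (sawF_meas lam g1 g2).comp (by fun_prop)
  have : IsProbabilityMeasure (volume.restrict (Set.Ioc (0:ℝ) 1)) := ⟨by simp⟩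
  obtain ⟨s, hs⟩ := exists_le_lintegral (μ := volume.restrict (Set.Ioc (0:ℝ) 1))
    (f := fun s => ∫⁻ x in Qs, sawF lam g1 g2 (u x + s)) (hm.lintegral_prod_right').aemeasurable
  refine ⟨s, hs.trans ?_⟩
  rw [lintegral_lintegral_swap hm.aemeasurable]
  simp only [sawF_avg lam hl]
  simp [Qs_vol]

/-- Sawtooth profile. -/
def saw (lam t : ℝ) : ℝ := min ((1 - lam) * Int.fract t) (lam * (1 - Int.fract t))

theorem saw_cont (lam : ℝ) (hl : lam ∈ Set.Icc (0:ℝ) 1) : Continuous (saw lam) := by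
  have := ContinuousOn.comp_fract'' (f := fun t : ℝ => min ((1 - lam) * t) (lam * (1 - t)))
    (by fun_prop) (by
      have := hl.1; have := hl.2
      simp [hl.1, hl.2])
  exact this

theorem saw_nonneg (lam : ℝ) (hl : lam ∈ Set.Icc (0:ℝ) 1) (t) : 0 ≤ saw lam t :=
  le_min (mul_nonneg (by linarith [hl.2]) (Int.fract_nonneg t))
    (mul_nonneg hl.1 (by linarith [Int.fract_lt_one t]))

theorem saw_le (lam : ℝ) (hl : lam ∈ Set.Icc (0:ℝ) 1) (t) : saw lam t ≤ 1 := by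
  refine (min_le_left _ _).trans ?_
  nlinarith [hl.1, hl.2, Int.fract_nonneg t, Int.fract_lt_one t]

/-- Finite set of gradients. -/
def gradD (lam : ℝ) (a : Fin 2 → ℝ) : Finset (Fin 2 → ℝ) :=
  {0, ![1, 0], ![-1, 0], ![0, 1], ![0, -1], (1 - lam) • a, (-lam) • a}

theorem constr (a : Fin 2 → ℝ) (lam : ℝ) (hl : lam ∈ Set.Icc (0:ℝ) 1) (k : ℝ) (hk : 0 < k)
    (s : ℝ) : ∃ (φ : E2 → ℝ) (S : Finset ((Fin 2 → ℝ) × ℝ)), Continuous φ ∧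
      (∀ x, 0 ≤ φ x) ∧ (∀ x, φ x ≤ 1 / k) ∧
      (∀ x, (¬ ∀ j, x j ∈ Set.Icc (1 / k) (1 - 1 / k)) → φ x = 0) ∧
      (∀ x ∈ Qs, ∃ q ∈ S, φ x = linF q.1 x + q.2) ∧
      (∀ᵐ x ∂(volume.restrict Qs), ∃ c ∈ gradD lam a, HasFDerivAt φ (linF c) x ∧
        ((∀ j, x j ∈ Set.Icc (2 / k) (1 - 2 / k)) →
          c = if Int.fract (k * linF a x + s) ≤ lam then (1 - lam) • a else (-lam) • a)) := by
  have hsc := saw_cont lam hl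
  set ψ : E2 → ℝ := fun x => saw lam (k * linF a x + s) / k with hψ
  set d : E2 → ℝ := fun x => min (min (x 0 - 1 / k) (1 - 1 / k - x 0))
    (min (x 1 - 1 / k) (1 - 1 / k - x 1)) with hd
  set φ : E2 → ℝ := fun x => max 0 (min (ψ x) (d x)) with hφ
  have hψ0 : ∀ x, 0 ≤ ψ x := fun x => div_nonneg (saw_nonneg lam hl _) hk.le
  have hψ1 : ∀ x, ψ x ≤ 1 / k := fun x => div_le_div_of_nonneg_right (saw_le lam hl _) hk.le
  have hψc : Continuous ψ := by
    have : Continuous fun x : E2 => saw lam (k * linF a x + s) := hsc.comp (by fun_prop)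
    exact this.div_const k
  have hφc : Continuous φ := by
    have : Continuous d := by fun_prop
    fun_prop
  have hk1 : 0 < 1 / k := by positivity
  obtain ⟨M, hM⟩ := exists_nat_gt (k * (|a 0| + |a 1|) + |s| + 1)
  let up : ℤ → (Fin 2 → ℝ) × ℝ := fun m => ((1 - lam) • a, (1 - lam) * (s - m) / k)
  let dn : ℤ → (Fin 2 → ℝ) × ℝ := fun m => ((-lam) • a, lam * (m + 1 - s) / k)
  let S : Finset ((Fin 2 → ℝ) × ℝ) :=
    {(0, 0), (![1, 0], -(1 / k)), (![-1, 0], 1 - 1 / k), (![0, 1], -(1 / k)),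
      (![0, -1], 1 - 1 / k)} ∪
      ((Finset.Icc (-(M:ℤ)) M).image up ∪ (Finset.Icc (-(M:ℤ)) M).image dn)
  have hfl : ∀ x ∈ Qs, ⌊k * linF a x + s⌋ ∈ Finset.Icc (-(M:ℤ)) M := by
    intro x hx
    have h0 := hx 0
    have h1 := hx 1
    have hb : |linF a x| ≤ |a 0| + |a 1| := by
      rw [linF_apply]
      refine (abs_add_le _ _).trans (add_le_add ?_ ?_)
      · rw [abs_mul, abs_of_pos h0.1]; nlinarith [abs_nonneg (a 0), h0.2]
      · rw [abs_mul, abs_of_pos h1.1]; nlinarith [abs_nonneg (a 1), h1.2]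
    have hb1 := abs_le.1 hb
    have hs1 := abs_le.1 (le_refl |s|)
    have e1 : k * linF a x ≤ k * (|a 0| + |a 1|) := mul_le_mul_of_nonneg_left hb1.2 hk.le
    have e2 : k * -(|a 0| + |a 1|) ≤ k * linF a x := mul_le_mul_of_nonneg_left hb1.1 hk.le
    rw [Finset.mem_Icc]
    constructor
    · rw [Int.le_floor]; push_cast; linarith
    · have : (⌊k * linF a x + s⌋ : ℝ) ≤ (M : ℤ) := by
        push_cast
        linarith [Int.floor_le (k * linF a x + s)]
      exact_mod_cast this
  have hψup : ∀ x, Int.fract (k * linF a x + s) ≤ lam →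
      ψ x = linF (up ⌊k * linF a x + s⌋).1 x + (up ⌊k * linF a x + s⌋).2 := by
    intro x hx
    have e : saw lam (k * linF a x + s) = (1 - lam) * Int.fract (k * linF a x + s) :=
      min_eq_left (by nlinarith)
    have e2 := Int.self_sub_floor (k * linF a x + s)
    rw [← e2] at e
    change saw lam (k * linF a x + s) / k = _
    rw [e]
    simp only [up, linF_apply, Pi.smul_apply, smul_eq_mul]
    generalize (⌊k * (a 0 * x 0 + a 1 * x 1) + s⌋ : ℝ) = z
    field_simp
    ring
  have hψdn : ∀ x, ¬ Int.fract (k * linF a x + s) ≤ lam →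
      ψ x = linF (dn ⌊k * linF a x + s⌋).1 x + (dn ⌊k * linF a x + s⌋).2 := by
    intro x hx
    have e : saw lam (k * linF a x + s) = lam * (1 - Int.fract (k * linF a x + s)) :=
      min_eq_right (by nlinarith)
    have e2 := Int.self_sub_floor (k * linF a x + s)
    rw [← e2] at e
    change saw lam (k * linF a x + s) / k = _
    rw [e]
    simp only [dn, linF_apply, Pi.smul_apply, smul_eq_mul]
    generalize (⌊k * (a 0 * x 0 + a 1 * x 1) + s⌋ : ℝ) = z
    field_simp
    ring
  have hupS : ∀ x ∈ Qs, up ⌊k * linF a x + s⌋ ∈ S := fun x hx =>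
    Finset.mem_union_right _ (Finset.mem_union_left _ (Finset.mem_image_of_mem _ (hfl x hx)))
  have hdnS : ∀ x ∈ Qs, dn ⌊k * linF a x + s⌋ ∈ S := fun x hx =>
    Finset.mem_union_right _ (Finset.mem_union_right _ (Finset.mem_image_of_mem _ (hfl x hx)))
  have hSD : ∀ q ∈ S, q.1 ∈ gradD lam a := by
    intro q hq
    simp only [S, Finset.mem_union, Finset.mem_image, Finset.mem_insert,
      Finset.mem_singleton] at hq
    simp only [gradD, Finset.mem_insert, Finset.mem_singleton]
    rcases hq with (rfl | rfl | rfl | rfl | rfl) | ⟨m, -, rfl⟩ | ⟨m, -, rfl⟩ <;> simp [up, dn]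
  have hsel : ∀ x ∈ Qs, ∃ q ∈ S, φ x = linF q.1 x + q.2 := by
    intro x hx
    have hψsel : ∃ q ∈ S, ψ x = linF q.1 x + q.2 := by
      by_cases h : Int.fract (k * linF a x + s) ≤ lam
      · exact ⟨_, hupS x hx, hψup x h⟩
      · exact ⟨_, hdnS x hx, hψdn x h⟩
    have hdsel : ∃ q ∈ S, d x = linF q.1 x + q.2 := by
      have c1 : ∃ q ∈ S, x 0 - 1 / k = linF q.1 x + q.2 :=
        ⟨(![1, 0], -(1 / k)), by simp [S], by simp [linF_apply]; ring⟩
      have c2 : ∃ q ∈ S, 1 - 1 / k - x 0 = linF q.1 x + q.2 :=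
        ⟨(![-1, 0], 1 - 1 / k), by simp [S], by simp [linF_apply]; ring⟩
      have c3 : ∃ q ∈ S, x 1 - 1 / k = linF q.1 x + q.2 :=
        ⟨(![0, 1], -(1 / k)), by simp [S], by simp [linF_apply]; ring⟩
      have c4 : ∃ q ∈ S, 1 - 1 / k - x 1 = linF q.1 x + q.2 :=
        ⟨(![0, -1], 1 - 1 / k), by simp [S], by simp [linF_apply]; ring⟩
      simp only [hd]
      rcases min_choice (min (x 0 - 1 / k) (1 - 1 / k - x 0))
        (min (x 1 - 1 / k) (1 - 1 / k - x 1)) with h | h <;> rw [h]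
      · rcases min_choice (x 0 - 1 / k) (1 - 1 / k - x 0) with h | h <;> rw [h] <;> assumption
      · rcases min_choice (x 1 - 1 / k) (1 - 1 / k - x 1) with h | h <;> rw [h] <;> assumption
    simp only [hφ]
    rcases max_choice 0 (min (ψ x) (d x)) with h | h <;> rw [h]
    · exact ⟨(0, 0), by simp [S], by simp [linF_apply]⟩
    · rcases min_choice (ψ x) (d x) with h | h <;> rw [h] <;> assumption
  refine ⟨φ, S, hφc, fun x => le_max_left _ _, fun x => max_le hk1.le
    ((min_le_left _ _).trans (hψ1 x)), ?_, hsel, ?_⟩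
  · intro x hx
    have : d x ≤ 0 := by
      by_contra! hpos
      apply hx
      simp only [hd, lt_min_iff] at hpos
      intro j
      fin_cases j
      · exact ⟨by change 1 / k ≤ x 0; linarith, by change x 0 ≤ 1 - 1 / k; linarith⟩
      · exact ⟨by change 1 / k ≤ x 1; linarith, by change x 1 ≤ 1 - 1 / k; linarith⟩
    exact max_eq_left ((min_le_right _ _).trans this)
  · filter_upwards [sel_ae φ hφc Qs Qs_open S hsel] with x hx
    obtain ⟨hxQ, q, hq, hder, huniq⟩ := hx
    refine ⟨q.1, hSD q hq, hder, fun hgood => ?_⟩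
    have hdx : 1 / k ≤ d x := by
      have h0 := hgood 0
      have h1 := hgood 1
      have : 2 / k = 1 / k + 1 / k := by ring
      rw [this] at h0 h1
      simp only [hd, le_min_iff]
      refine ⟨⟨?_, ?_⟩, ?_, ?_⟩ <;> linarith [h0.1, h0.2, h1.1, h1.2]
    have hφψ : φ x = ψ x := by
      simp only [hφ]
      rw [min_eq_left ((hψ1 x).trans hdx), max_eq_right (hψ0 x)]
    split_ifs with h
    · rw [← huniq _ (hupS x hxQ) (hφψ.trans (hψup x h))]
    · rw [← huniq _ (hdnS x hxQ) (hφψ.trans (hψdn x h))]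

/-- Boundary layer. -/
def badS (n : ℕ) : Set E2 :=
  {x | x ∈ Qs ∧ ¬ ∀ j, x j ∈ Set.Icc (2 / ((n:ℝ) + 1)) (1 - 2 / ((n:ℝ) + 1))}

theorem badS_meas (n : ℕ) : MeasurableSet (badS n) := by
  refine Qs_open.measurableSet.inter (MeasurableSet.compl ?_)
  have : {x : E2 | ∀ j, x j ∈ Set.Icc (2 / ((n:ℝ) + 1)) (1 - 2 / ((n:ℝ) + 1))} =
      ⋂ j : Fin 2, {x : E2 | x j ∈ Set.Icc (2 / ((n:ℝ) + 1)) (1 - 2 / ((n:ℝ) + 1))} := by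
    ext x; simp
  change MeasurableSet {x : E2 | ∀ j, x j ∈ Set.Icc (2 / ((n:ℝ) + 1)) (1 - 2 / ((n:ℝ) + 1))}
  rw [this]
  refine MeasurableSet.iInter fun j => ?_
  exact measurableSet_Icc.preimage (by fun_prop : Continuous fun x : E2 => x j).measurable

theorem badS_tendsto : Tendsto (fun n => volume (badS n)) atTop (nhds 0) := by
  have hanti : Antitone badS := by
    intro m n hmn x hx
    refine ⟨hx.1, fun h => hx.2 fun j => ?_⟩
    have h2 : 2 / ((n:ℝ) + 1) ≤ 2 / ((m:ℝ) + 1) := by gcongr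
    exact ⟨h2.trans (h j).1, (h j).2.trans (by linarith)⟩
  have h := tendsto_measure_iInter_atTop (μ := (volume : Measure E2)) (s := badS)
    (fun n => (badS_meas n).nullMeasurableSet) hanti
    ⟨0, ne_top_of_le_ne_top (by rw [Qs_vol]; simp) (measure_mono (t := Qs) fun x hx => hx.1)⟩
  have he : ⋂ n, badS n = ∅ := by
    ext x
    simp only [Set.mem_iInter, Set.mem_empty_iff_false, iff_false, not_forall]
    by_cases hx : x ∈ Qs
    · have ht : Tendsto (fun n : ℕ => 2 / ((n:ℝ) + 1)) atTop (nhds 0) := by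
        have := (tendsto_one_div_add_atTop_nhds_zero_nat (𝕜 := ℝ)).const_mul 2
        simpa [div_eq_mul_inv] using this
      have hev : ∀ᶠ n : ℕ in atTop, ∀ j, 2 / ((n:ℝ) + 1) < min (x j) (1 - x j) := by
        rw [eventually_all]
        intro j
        exact ht.eventually_lt_const (lt_min (hx j).1 (by linarith [(hx j).2]))
      obtain ⟨n, hn⟩ := hev.exists
      refine ⟨n, fun h => h.2 fun j => ?_⟩
      have := lt_min_iff.1 (hn j)
      exact ⟨this.1.le, by linarith [this.2]⟩
    · exact ⟨0, fun h => hx h.1⟩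
  rw [he, measure_empty] at h
  exact h

theorem vnorm_smul (t : ℝ) (ht : 0 ≤ t) (b : Fin 3 → ℝ) : vnorm (t • b) = t * vnorm b := by
  unfold vnorm
  have : ∑ i, (t • b) i ^ 2 = t ^ 2 * ∑ i, b i ^ 2 := by
    rw [Finset.mul_sum]; exact Finset.sum_congr rfl fun i _ => by simp; ring
  rw [this, Real.sqrt_mul (sq_nonneg t), Real.sqrt_sq ht]

theorem family (p : ℝ) (hp : 1 < p) (W₀ : Matrix (Fin 3) (Fin 2) ℝ → ℝ≥0∞)
    (hW₀top : ∀ A, W₀ A = ⊤ ↔ crossCols A = 0)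
    (g : Matrix (Fin 3) (Fin 2) ℝ → ℝ≥0∞) (hg : ∀ B, g B ≤ W₀ B)
    (A : Matrix (Fin 3) (Fin 2) ℝ) (a : Fin 2 → ℝ) (b : Fin 3 → ℝ) (lam : ℝ)
    (hl : lam ∈ Set.Icc (0:ℝ) 1) (hb : b ⬝ᵥ crossCols A ≠ 0) :
    ∃ θ : ℕ → E2 → (Fin 3 → ℝ),
      (∀ n, PiecewiseAffineOn (θ n) Qs ∧ Continuous (θ n) ∧
        ∃ K, IsCompact K ∧ K ⊆ Qs ∧ ∀ x ∉ K, θ n x = 0) ∧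
      Tendsto (fun n => ∫⁻ x in Qs, ENNReal.ofReal (vnorm (θ n x) ^ p)) atTop (nhds 0) ∧
      (∀ n, AffStar (fun x => (fun i' => (∑ j, A i' j * x j) + θ n x i')) Qs) ∧
      Filter.limsup (fun n => ∫⁻ x in Qs, g (A + jacMat (θ n) x)) atTop ≤
        ENNReal.ofReal (1 - lam) * g (A - lam • Matrix.vecMulVec b a) +
        ENNReal.ofReal lam * g (A + (1 - lam) • Matrix.vecMulVec b a) := by
  set g1 := g (A - lam • Matrix.vecMulVec b a)
  set g2 := g (A + (1 - lam) • Matrix.vecMulVec b a)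
  have hs : ∀ n : ℕ, ∃ s : ℝ, ∫⁻ x in Qs, sawF lam g1 g2 (((n:ℝ) + 1) * linF a x + s) ≤
      ENNReal.ofReal (1 - lam) * g1 + ENNReal.ofReal lam * g2 := fun n =>
    exists_shift lam hl g1 g2 (fun x => ((n:ℝ) + 1) * linF a x) (by fun_prop)
  choose s hs using hs
  have hc := fun n : ℕ => constr a lam hl ((n:ℝ) + 1) (by positivity) (s n)
  choose φ S hφc hφ0 hφ1 hφK hsel hae using hc
  refine ⟨fun n x => φ n x • b, fun n => ⟨?_, ?_, ?_⟩, ?_, ?_, ?_⟩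
  · have := sel_pwa (φ n) (hφc n) Qs Qs_open (S n) (hsel n) 0 b
    simpa using this
  · exact (hφc n).smul continuous_const
  · refine ⟨{x : E2 | ∀ j, x j ∈ Set.Icc (1 / ((n:ℝ) + 1)) (1 - 1 / ((n:ℝ) + 1))}, ?_, ?_, ?_⟩
    · have h := (isCompact_univ_pi (fun _ : Fin 2 =>
        isCompact_Icc (a := 1 / ((n:ℝ) + 1)) (b := 1 - 1 / ((n:ℝ) + 1)))).image
          (PiLp.continuous_toLp 2 (fun _ : Fin 2 => ℝ))
      convert h using 1
      ext x
      simp only [Set.mem_image, Set.mem_pi, Set.mem_univ, true_imp_iff, Set.mem_ofPred_eq]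
      constructor
      · intro hx; exact ⟨x.ofLp, hx, rfl⟩
      · rintro ⟨y, hy, rfl⟩; exact hy
    · intro x hx j
      have h1 : 0 < 1 / ((n:ℝ) + 1) := by positivity
      exact ⟨h1.trans_le (hx j).1, by linarith [(hx j).2]⟩
    · intro x hx
      simp only [hφK n x hx, zero_smul]
  · have hv : 0 ≤ vnorm b := Real.sqrt_nonneg _
    have hbd : ∀ n : ℕ, ∫⁻ x in Qs, ENNReal.ofReal (vnorm (φ n x • b) ^ p) ≤
        ENNReal.ofReal ((1 / ((n:ℝ) + 1) * vnorm b) ^ p) := by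
      intro n
      have : ∫⁻ x in Qs, ENNReal.ofReal (vnorm (φ n x • b) ^ p) ≤
          ∫⁻ x in Qs, ENNReal.ofReal ((1 / ((n:ℝ) + 1) * vnorm b) ^ p) := by
        refine lintegral_mono fun x => ENNReal.ofReal_le_ofReal ?_
        rw [vnorm_smul _ (hφ0 n x)]
        refine Real.rpow_le_rpow (mul_nonneg (hφ0 n x) hv) ?_ (by linarith)
        exact mul_le_mul_of_nonneg_right (hφ1 n x) hv
      simpa [Qs_vol] using this
    refine tendsto_of_tendsto_of_tendsto_of_le_of_le tendsto_const_nhds ?_ (fun _ => zero_le) hbd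
    have h1 : Tendsto (fun n : ℕ => (1 / ((n:ℝ) + 1) * vnorm b) ^ p) atTop (nhds 0) := by
      have := ((tendsto_one_div_add_atTop_nhds_zero_nat (𝕜 := ℝ)).mul_const (vnorm b)).rpow_const
        (p := p) (Or.inr (by linarith))
      simpa [Real.zero_rpow (by linarith : p ≠ 0)] using this
    simpa using ENNReal.tendsto_ofReal h1
  · intro n
    have := affStar_of A b hb (φ n) (hφc n) Qs Qs_open (S n) (hsel n)
    convert this using 1
    ext x i
    simp [matL_apply]
  · set C : ℝ≥0∞ := ∑ c ∈ gradD lam a, W₀ (A + Matrix.vecMulVec b c) with hC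
    have hCtop : C ≠ ⊤ := by
      rw [hC]
      refine ENNReal.sum_ne_top.2 fun c _ h => ?_
      have h0 := (hW₀top _).1 h
      have := cross_dot A c b
      rw [h0] at this
      exact hb (by rw [← this]; simp)
    have hbound : ∀ n, ∫⁻ x in Qs, g (A + jacMat (fun x => φ n x • b) x) ≤
        (ENNReal.ofReal (1 - lam) * g1 + ENNReal.ofReal lam * g2) + C * volume (badS n) := by
      intro n
      have h1 : ∫⁻ x in Qs, g (A + jacMat (fun x => φ n x • b) x) ≤
          ∫⁻ x in Qs, (sawF lam g1 g2 (((n:ℝ) + 1) * linF a x + s n) +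
            (badS n).indicator (fun _ => C) x) := by
        refine lintegral_mono_ae ?_
        filter_upwards [hae n, ae_restrict_mem Qs_open.measurableSet] with x hx hxQ
        obtain ⟨c, hcD, hder, hgood⟩ := hx
        rw [jacMat_smul (φ n) b c x hder]
        by_cases hbad : x ∈ badS n
        · rw [Set.indicator_of_mem hbad]
          refine le_trans ((hg _).trans ?_) le_add_self
          exact Finset.single_le_sum (f := fun c => W₀ (A + Matrix.vecMulVec b c))
            (fun _ _ => zero_le) hcD
        · rw [Set.indicator_of_notMem hbad, add_zero]
          have hgd : ∀ j, x j ∈ Set.Icc (2 / ((n:ℝ) + 1)) (1 - 2 / ((n:ℝ) + 1)) := by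
            by_contra h
            exact hbad ⟨hxQ, h⟩
          rw [hgood hgd]
          unfold sawF
          split_ifs with h
          · apply le_of_eq
            simp only [g2]
            congr 2
            ext i j; simp [Matrix.vecMulVec_apply]; ring
          · apply le_of_eq
            simp only [g1]
            congr 1
            ext i j; simp [Matrix.vecMulVec_apply]; ring
      refine h1.trans ?_
      rw [lintegral_add_right _ (measurable_const.indicator (badS_meas n)),
        lintegral_indicator_const (badS_meas n)]
      refine add_le_add (hs n) (mul_le_mul_right (Measure.restrict_apply_le _ _) _)
    have hlim : Tendsto (fun n => (ENNReal.ofReal (1 - lam) * g1 + ENNReal.ofReal lam * g2) +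
        C * volume (badS n)) atTop
        (nhds (ENNReal.ofReal (1 - lam) * g1 + ENNReal.ofReal lam * g2)) := by
      have := (ENNReal.Tendsto.const_mul badS_tendsto (Or.inr hCtop)).const_add
        (ENNReal.ofReal (1 - lam) * g1 + ENNReal.ofReal lam * g2)
      simpa using this
    rw [← hlim.limsup_eq]
    exact limsup_le_limsup (Eventually.of_forall hbound)

theorem exists_good (f : Matrix (Fin 3) (Fin 2) ℝ → ℝ≥0∞) (hf : Continuous f)
    (A : Matrix (Fin 3) (Fin 2) ℝ) (hA : crossCols A ≠ 0) (hfA : f A ≠ ⊤) (i : ℕ)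
    (ε : ℝ≥0∞) (hε : 0 < ε) :
    ∃ (a : Fin 2 → ℝ) (b : Fin 3 → ℝ) (lam : ℝ), lam ∈ Set.Icc (0:ℝ) 1 ∧
      b ⬝ᵥ crossCols A ≠ 0 ∧
      ENNReal.ofReal (1 - lam) * RIter f i (A - lam • Matrix.vecMulVec b a) +
        ENNReal.ofReal lam * RIter f i (A + (1 - lam) • Matrix.vecMulVec b a) ≤
        RIter f (i+1) A + ε := by
  have hfin : RIter f (i+1) A ≠ ⊤ := ne_top_of_le_ne_top hfA (RIter_le f (i+1) A)
  have hlt : RIter f (i+1) A < RIter f (i+1) A + ε := ENNReal.lt_add_right hfin hε.ne'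
  have hlt2 : (⨅ (a : Fin 2 → ℝ) (b : Fin 3 → ℝ) (lam : ℝ) (_ : lam ∈ Set.Icc (0:ℝ) 1),
        ENNReal.ofReal (1 - lam) * RIter f i (A - lam • Matrix.vecMulVec b a) +
        ENNReal.ofReal lam * RIter f i (A + (1 - lam) • Matrix.vecMulVec b a)) <
        RIter f (i+1) A + ε := hlt
  simp only [iInf_lt_iff] at hlt2
  obtain ⟨a, b, lam, hl, h⟩ := hlt2
  set N := crossCols A
  have hNN : N ⬝ᵥ N ≠ 0 := fun h0 => hA (dotProduct_self_eq_zero.1 h0)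
  have hu := usc_pair (RIter f i) (RIter_usc f hf i)
    (fun t : ℝ => A - lam • Matrix.vecMulVec (b + t • N) a)
    (fun t : ℝ => A + (1 - lam) • Matrix.vecMulVec (b + t • N) a) (by fun_prop) (by fun_prop)
    (1 - lam) lam
  have hev := hu 0 (RIter f (i+1) A + ε) (by simpa using h)
  have hev2 : ∀ᶠ t : ℝ in nhdsWithin 0 {0}ᶜ, t ≠ -(b ⬝ᵥ N) / (N ⬝ᵥ N) := by
    by_cases h0 : (0:ℝ) = -(b ⬝ᵥ N) / (N ⬝ᵥ N)
    · rw [← h0]; exact self_mem_nhdsWithin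
    · exact nhdsWithin_le_nhds (isOpen_ne.mem_nhds h0)
  obtain ⟨t, ht1, ht2⟩ := ((hev.filter_mono nhdsWithin_le_nhds).and hev2).exists
  refine ⟨a, b + t • N, lam, hl, ?_, ht1.le⟩
  intro h0
  apply ht2
  rw [eq_div_iff hNN]
  simp only [add_dotProduct, smul_dotProduct, smul_eq_mul] at h0
  linarith

/-- the basic construction of oscillating perturbations on the unit square
Q = (0,1)² realizing the next Kohn–Strang iterate. -/
theorem stmt16
    (p C₁ : ℝ) (hp : 1 < p) (hC₁ : 0 < C₁)
    (W₀ : Matrix (Fin 3) (Fin 2) ℝ → ℝ≥0∞)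
    -- W₀ continuous as an extended-valued function
    (hW₀cont : Continuous W₀)
    -- W₀ p-coercive
    (hW₀coer : ∀ A, ENNReal.ofReal (C₁ * mnorm A ^ p - 1 / C₁) ≤ W₀ A)
    -- W₀(A) = +∞ iff A¹ ∧ A² = 0
    (hW₀top : ∀ A, W₀ A = ⊤ ↔ crossCols A = 0)
    -- p-growth where |A¹ ∧ A²| is bounded away from 0
    (hW₀grow : ∀ δ : ℝ, 0 < δ → ∃ c : ℝ, 0 < c ∧ ∀ A, δ ≤ vnorm (crossCols A) →
      W₀ A ≤ ENNReal.ofReal (c * (1 + mnorm A ^ p)))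
    (A : Matrix (Fin 3) (Fin 2) ℝ) (hA : A.rank = 2) (i : ℕ) :
    ∃ θ : ℕ → ℕ → EuclideanSpace ℝ (Fin 2) → (Fin 3 → ℝ),
      -- θ_{n,ℓ} ∈ Aff_c(Q, ℝ³), where Q = (0,1)²
      (∀ n l, PiecewiseAffineOn (θ n l)
          {x : EuclideanSpace ℝ (Fin 2) | ∀ j, x j ∈ Set.Ioo (0:ℝ) 1} ∧
        Continuous (θ n l) ∧
        ∃ K, IsCompact K ∧ K ⊆ {x : EuclideanSpace ℝ (Fin 2) | ∀ j, x j ∈ Set.Ioo (0:ℝ) 1} ∧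
          ∀ x ∉ K, θ n l x = 0) ∧
      -- (i) L^p convergence to 0 as n → ∞
      (∀ l, Tendsto (fun n => ∫⁻ x in
          {x : EuclideanSpace ℝ (Fin 2) | ∀ j, x j ∈ Set.Ioo (0:ℝ) 1},
          ENNReal.ofReal (vnorm (θ n l x) ^ p)) atTop (nhds 0)) ∧
      -- (ii) x ↦ Ax + θ_{n,ℓ}(x) ∈ Aff*(Q, ℝ³)
      (∀ n l, AffStar (fun x => (fun i' => (∑ j, A i' j * x j) + θ n l x i'))
        {x : EuclideanSpace ℝ (Fin 2) | ∀ j, x j ∈ Set.Ioo (0:ℝ) 1}) ∧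
      -- (iii)
      (Filter.limsup (fun l => Filter.limsup
          (fun n => ∫⁻ x in {x : EuclideanSpace ℝ (Fin 2) | ∀ j, x j ∈ Set.Ioo (0:ℝ) 1},
            RIter W₀ i (A + jacMat (θ n l) x)) atTop) atTop
        ≤ RIter W₀ (i+1) A) := by
  have hN := crossCols_ne A hA
  have hfA : W₀ A ≠ ⊤ := fun h => hN ((hW₀top A).1 h)
  have hgood := fun l : ℕ => exists_good W₀ hW₀cont A hN hfA i (ENNReal.ofReal (1 / ((l:ℝ) + 1)))
    (ENNReal.ofReal_pos.2 (by positivity))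
  choose a b lam hl hb hle using hgood
  have hfam := fun l : ℕ => family p hp W₀ hW₀top (RIter W₀ i) (RIter_le W₀ i) A (a l) (b l)
    (lam l) (hl l) (hb l)
  choose θ h1 h2 h3 h4 using hfam
  refine ⟨fun n l => θ l n, fun n l => h1 l n, fun l => h2 l, fun n l => h3 l n, ?_⟩
  have hlim : Tendsto (fun l : ℕ => RIter W₀ (i+1) A + ENNReal.ofReal (1 / ((l:ℝ) + 1))) atTop
      (nhds (RIter W₀ (i+1) A)) := by
    have := (ENNReal.tendsto_ofReal
      (tendsto_one_div_add_atTop_nhds_zero_nat (𝕜 := ℝ))).const_add (RIter W₀ (i+1) A)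
    simpa using this
  rw [← hlim.limsup_eq]
  exact limsup_le_limsup (Eventually.of_forall fun l => (h4 l).trans (hle l))
end
end

section
/- Let 1 ≤ p < ∞, let U ⊂ ℝ² be an open bounded set with Lipschitz boundary and let v ∈ Aff*(U, ℝ³). Then there exist a sequence v_j ∈ C¹(cl(U), ℝ³) and θ > 0 such that: (i) v_j → v in W^{1,p}(U, ℝ³), i.e. ∫_U |v_j − v|^p dx → 0 and ∫_U |∇v_j − ∇v|^p dx → 0, and ‖∇v_j‖_{L^∞} ≤ 2‖∇v‖_{L^∞} for every j; (ii) |∂₁v_j(x) ∧ ∂₂v_j(x)| ≥ θ for every x ∈ cl(U) and every j ≥ 1. -/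
open Filter MeasureTheory Set
open scoped ENNReal

noncomputable section

lemma aux_field (U : Set (EuclideanSpace ℝ (Fin 2))) (hUb : Bornology.IsBounded U)
    (hUl : IsLipschitzGraphDomain (m := 1) U) :
    ∃ (X : EuclideanSpace ℝ (Fin 2) → EuclideanSpace ℝ (Fin 2)) (ε₀ : ℝ), ContDiff ℝ 1 X ∧
      HasCompactSupport X ∧ 0 < ε₀ ∧ ∀ ε : ℝ, 0 < ε → ε ≤ ε₀ → ∀ x ∈ closure U,
        x + ε • X x ∈ U := by
  classical
  obtain ⟨hUo, hU⟩ := hUl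
  have hloc : ∀ z ∈ frontier U, ∃ (e : EuclideanSpace ℝ (Fin 2)) (r : ℝ), 0 < r ∧ ‖e‖ = 1 ∧
      ∀ x ∈ closure U, ∀ t : ℝ, 0 < t → x ∈ Metric.ball z r → x + t • e ∈ Metric.ball z r →
        x + t • e ∈ U := by
    intro z hz
    obtain ⟨b, K, f, r, hr, hf, hb⟩ := hU z hz
    refine ⟨b (Fin.last 1), r, hr, b.orthonormal.1 _, ?_⟩
    intro x hx t ht hxb hxt
    rw [hb _ hxt]
    have hle : f (fun i => b.repr x i.castSucc) ≤ b.repr x (Fin.last 1) := by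
      have hx' : x ∈ closure (U ∩ Metric.ball z r) := Metric.isOpen_ball.closure_inter ⟨hx, hxb⟩
      have hcl : IsClosed {x : EuclideanSpace ℝ (Fin 2) |
          f (fun i => b.repr x i.castSucc) ≤ b.repr x (Fin.last 1)} := by
        apply isClosed_le
        · exact hf.continuous.comp (by fun_prop)
        · fun_prop
      have hsub : U ∩ Metric.ball z r ⊆ {x : EuclideanSpace ℝ (Fin 2) |
          f (fun i => b.repr x i.castSucc) ≤ b.repr x (Fin.last 1)} := by
        rintro y ⟨hy, hyb⟩
        exact ((hb y hyb).1 hy).le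
      exact closure_minimal hsub hcl hx'
    have h1 : (fun i : Fin 1 => b.repr (x + t • b (Fin.last 1)) i.castSucc)
        = fun i => b.repr x i.castSucc := by
      funext i
      have : i.castSucc ≠ Fin.last 1 := (Fin.castSucc_lt_last i).ne
      have h0 : (EuclideanSpace.single (Fin.last 1) (1:ℝ) : EuclideanSpace ℝ (Fin (1+1))) i.castSucc = 0 := by
        rw [PiLp.single_apply, if_neg this]
      rw [map_add, map_smul, b.repr_self, PiLp.add_apply, PiLp.smul_apply, h0]
      simp
    have h2 : b.repr (x + t • b (Fin.last 1)) (Fin.last 1) = b.repr x (Fin.last 1) + t := by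
      simp [map_add, map_smul]
    rw [h1, h2]
    linarith
  choose! e r hr he hstep using hloc
  have hcomp : IsCompact (frontier U) :=
    Metric.isCompact_of_isClosed_isBounded isClosed_frontier
      (hUb.closure.subset frontier_subset_closure)
  obtain ⟨T, hTs, hT⟩ := hcomp.elim_nhds_subcover (fun z => Metric.ball z (if 0 < r z then r z / 4 else 1))
    (fun z hz => Metric.ball_mem_nhds _ (by split_ifs <;> linarith))
  let φ : ∀ z : EuclideanSpace ℝ (Fin 2), ContDiffBump z := fun z =>
    if h : 0 < r z then ⟨r z / 4, r z / 2, by linarith, by linarith⟩ else ⟨1, 2, by norm_num, by norm_num⟩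
  have hφ : ∀ z, 0 < r z → (φ z).rIn = r z / 4 ∧ (φ z).rOut = r z / 2 := by
    intro z hz
    simp [φ, hz]
  obtain ⟨ρ, hρ, hρT⟩ : ∃ ρ : ℝ, 0 < ρ ∧ ∀ z ∈ T, ρ ≤ r z := by
    clear hT
    induction T using Finset.induction_on with
    | empty => exact ⟨1, one_pos, by simp⟩
    | insert a s ha ih =>
      obtain ⟨ρ, h0, h1⟩ := ih (fun z hz => hTs z (Finset.mem_insert_of_mem hz))
      refine ⟨min ρ (r a), lt_min h0 (hr a (hTs a (Finset.mem_insert_self _ _))), ?_⟩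
      intro z hz
      rcases Finset.mem_insert.1 hz with rfl | hz
      · exact min_le_right _ _
      · exact (min_le_left _ _).trans (h1 z hz)
  refine ⟨fun x => ∑ z ∈ T, φ z x • e z, ρ / 2 / (T.card + 1), ?_, ?_, by positivity, ?_⟩
  · exact ContDiff.sum fun z _ => (φ z).contDiff.smul contDiff_const
  · have : ∀ s : Finset (EuclideanSpace ℝ (Fin 2)),
        HasCompactSupport (fun x => ∑ z ∈ s, φ z x • e z) := by
      intro s
      induction s using Finset.induction_on with
      | empty => simp only [Finset.sum_empty]; exact HasCompactSupport.zero
      | insert a s ha ih =>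
        simp only [Finset.sum_insert ha]
        exact HasCompactSupport.add ((φ a).hasCompactSupport.smul_right) ih
    exact this T
  · intro ε hε hε' x hx
    have hcard : ε * T.card < ρ / 2 := by
      have h1 : ε * (T.card + 1) ≤ ρ / 2 := by
        rwa [le_div_iff₀ (by positivity)] at hε'
      nlinarith
    have hnorm : ∀ s ⊆ T, ‖ε • ∑ z ∈ s, φ z x • e z‖ < ρ / 2 := by
      intro s hs
      have h1 : ‖∑ z ∈ s, φ z x • e z‖ ≤ ∑ z ∈ s, (1:ℝ) := by
        refine norm_sum_le_of_le _ fun z hz => ?_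
        rw [norm_smul, he z (hTs z (hs hz)), mul_one, Real.norm_eq_abs, abs_of_nonneg (φ z).nonneg]
        exact (φ z).le_one
      rw [norm_smul, Real.norm_eq_abs, abs_of_pos hε]
      have h2 : (s.card : ℝ) ≤ T.card := by exact_mod_cast Finset.card_le_card hs
      simp at h1
      nlinarith
    have key : ∀ s ⊆ T, x + ε • ∑ z ∈ s, φ z x • e z ∈ closure U ∧
        ((x ∈ U ∨ ∃ z ∈ s, 0 < φ z x) → x + ε • ∑ z ∈ s, φ z x • e z ∈ U) := by
      intro s
      induction s using Finset.induction_on with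
      | empty => intro _; simp [hx]
      | insert a s ha ih =>
        intro hs
        have hsT : s ⊆ T := (Finset.subset_insert _ _).trans hs
        obtain ⟨ih1, ih2⟩ := ih hsT
        have haT : a ∈ T := hs (Finset.mem_insert_self _ _)
        have hra := hr a (hTs a haT)
        have hb : ∀ s ⊆ T, 0 < φ a x → x + ε • ∑ z ∈ s, φ z x • e z ∈ Metric.ball a (r a) := by
          intro s hs hpos
          have hxa : x ∈ Metric.ball a (φ a).rOut := by
            rw [← (φ a).support_eq]; exact hpos.ne'
          rw [(hφ a hra).2, Metric.mem_ball, dist_eq_norm] at hxa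
          rw [Metric.mem_ball, dist_eq_norm]
          have := norm_add_le (x - a) (ε • ∑ z ∈ s, φ z x • e z)
          have h3 := hnorm s hs
          have h4 := hρT a haT
          rw [show x + ε • ∑ z ∈ s, φ z x • e z - a = (x - a) + ε • ∑ z ∈ s, φ z x • e z by abel]
          linarith
        have heq : x + ε • ∑ z ∈ insert a s, φ z x • e z
            = (x + ε • ∑ z ∈ s, φ z x • e z) + (ε * φ a x) • e a := by
          rw [Finset.sum_insert ha, smul_add, smul_smul]; abel
        rcases (φ a).nonneg (x := x) |>.eq_or_lt with h0 | h0
        · have heq' : x + ε • ∑ z ∈ insert a s, φ z x • e z = x + ε • ∑ z ∈ s, φ z x • e z := by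
            rw [heq, ← h0]; simp
          rw [heq']
          refine ⟨ih1, fun h => ih2 ?_⟩
          rcases h with h | ⟨z, hz, hz'⟩
          · exact Or.inl h
          · rcases Finset.mem_insert.1 hz with rfl | hz
            · exact absurd h0 hz'.ne
            · exact Or.inr ⟨z, hz, hz'⟩
        · have hin : x + ε • ∑ z ∈ insert a s, φ z x • e z ∈ U := by
            have hb2 := hb _ hs h0
            rw [heq] at hb2 ⊢
            exact hstep a (hTs a haT) _ ih1 _ (by positivity) (hb _ hsT h0) hb2
          exact ⟨subset_closure hin, fun _ => hin⟩
    refine (key T subset_rfl).2 ?_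
    by_cases hxU : x ∈ U
    · exact Or.inl hxU
    · right
      have hxf : x ∈ frontier U := by
        rw [hUo.frontier_eq]; exact ⟨hx, hxU⟩
      have := hT hxf
      simp only [mem_iUnion] at this
      obtain ⟨z, hz, hxz⟩ := this
      have hrz := hr z (hTs z hz)
      refine ⟨z, hz, ?_⟩
      apply (φ z).pos_of_mem_ball
      rw [(hφ z hrz).2]
      rw [if_pos hrz] at hxz
      exact Metric.ball_subset_ball (by linarith) hxz

/-- Data of a piecewise affine decomposition. -/
structure PAData (v : EuclideanSpace ℝ (Fin 2) → Fin 3 → ℝ) (U : Set (EuclideanSpace ℝ (Fin 2)))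
    (N : ℕ) (V : Fin N → Set (EuclideanSpace ℝ (Fin 2)))
    (L : Fin N → EuclideanSpace ℝ (Fin 2) →L[ℝ] (Fin 3 → ℝ)) (c : Fin N → Fin 3 → ℝ) : Prop where
  hU : IsOpen U
  hb : Bornology.IsBounded U
  hc : ContinuousOn v U
  ho : ∀ i, IsOpen (V i)
  hs : ∀ i, V i ⊆ U
  hd : ∀ i j, i ≠ j → Disjoint (V i) (V j)
  hn : volume (U \ ⋃ i, V i) = 0
  ha : ∀ i, ∀ x ∈ V i, v x = L i x + c i

namespace PAData

variable {v : EuclideanSpace ℝ (Fin 2) → Fin 3 → ℝ} {U : Set (EuclideanSpace ℝ (Fin 2))}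
    {N : ℕ} {V : Fin N → Set (EuclideanSpace ℝ (Fin 2))}
    {L : Fin N → EuclideanSpace ℝ (Fin 2) →L[ℝ] (Fin 3 → ℝ)} {c : Fin N → Fin 3 → ℝ}

lemma exists_mem (h : PAData v U N V L c) {x : EuclideanSpace ℝ (Fin 2)} (hx : x ∈ U) :
    ∃ i, x ∈ closure (V i) := by
  by_contra hcon
  push Not at hcon
  have hop : IsOpen (U ∩ ⋂ i, (closure (V i))ᶜ) :=
    h.hU.inter (isOpen_iInter_of_finite fun i => isClosed_closure.isOpen_compl)
  have hne : (U ∩ ⋂ i, (closure (V i))ᶜ).Nonempty := ⟨x, hx, by simpa using hcon⟩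
  have hpos := hop.measure_pos volume hne
  have hsub : U ∩ ⋂ i, (closure (V i))ᶜ ⊆ U \ ⋃ i, V i := by
    rintro y ⟨hy, hy'⟩
    refine ⟨hy, ?_⟩
    simp only [mem_iUnion, not_exists]
    intro i hi
    exact (mem_iInter.1 hy' i) (subset_closure hi)
  have := measure_mono_null hsub h.hn
  exact hpos.ne' this

lemma val (h : PAData v U N V L c) {x : EuclideanSpace ℝ (Fin 2)} (hx : x ∈ U) {i : Fin N}
    (hi : x ∈ closure (V i)) : v x = L i x + c i := by
  have hne : (nhdsWithin x (V i)).NeBot := mem_closure_iff_nhdsWithin_neBot.1 hi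
  have h1 : Tendsto v (nhdsWithin x (V i)) (nhds (v x)) :=
    ((h.hc.continuousAt (h.hU.mem_nhds hx)).tendsto).mono_left nhdsWithin_le_nhds
  have h2 : Tendsto (fun x => L i x + c i) (nhdsWithin x (V i)) (nhds (L i x + c i)) := by
    have : Continuous (fun x => L i x + c i) := by fun_prop
    exact (this.tendsto x).mono_left nhdsWithin_le_nhds
  refine tendsto_nhds_unique h1 (h2.congr' ?_)
  filter_upwards [self_mem_nhdsWithin] with y hy
  exact (h.ha i y hy).symm

/-- neighborhood of `x` meeting only the pieces adherent to `x` -/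
def nb (U : Set (EuclideanSpace ℝ (Fin 2))) (V : Fin N → Set (EuclideanSpace ℝ (Fin 2)))
    (x : EuclideanSpace ℝ (Fin 2)) : Set (EuclideanSpace ℝ (Fin 2)) :=
  {y | y ∈ U ∧ ∀ i, y ∈ closure (V i) → x ∈ closure (V i)}

lemma isOpen_nb (h : PAData v U N V L c) (x : EuclideanSpace ℝ (Fin 2)) : IsOpen (nb U V x) := by
  have : nb U V x = U ∩ ⋂ i, {y | y ∈ closure (V i) → x ∈ closure (V i)} := by
    ext y; simp [nb]
  rw [this]
  refine h.hU.inter (isOpen_iInter_of_finite fun i => ?_)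
  by_cases hx : x ∈ closure (V i)
  · simp [hx]
  · simp only [hx, imp_false]
    exact isClosed_closure.isOpen_compl

lemma mem_nb {x : EuclideanSpace ℝ (Fin 2)} (hx : x ∈ U) : x ∈ nb U V x := ⟨hx, fun _ h => h⟩

lemma loc_lip (h : PAData v U N V L c) {x y : EuclideanSpace ℝ (Fin 2)} (hx : x ∈ U)
    (hy : y ∈ nb U V x) : ‖v y - v x‖ ≤ (∑ i, ‖L i‖) * ‖y - x‖ := by
  obtain ⟨i, hi⟩ := h.exists_mem hy.1
  rw [h.val hy.1 hi, h.val hx (hy.2 i hi)]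
  have : L i y + c i - (L i x + c i) = L i (y - x) := by rw [map_sub]; abel
  rw [this]
  refine ((L i).le_opNorm _).trans ?_
  gcongr
  exact Finset.single_le_sum (f := fun i => ‖L i‖) (fun i _ => norm_nonneg _) (Finset.mem_univ i)

lemma lip (h : PAData v U N V L c) {S : Set (EuclideanSpace ℝ (Fin 2))} (hS : Convex ℝ S)
    (hSU : S ⊆ U) {x y : EuclideanSpace ℝ (Fin 2)} (hx : x ∈ S) (hy : y ∈ S) :
    ‖v y - v x‖ ≤ (∑ i, ‖L i‖) * ‖y - x‖ := by
  set C := ∑ i, ‖L i‖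
  have hC : 0 ≤ C := Finset.sum_nonneg fun i _ => norm_nonneg _
  let γ : ℝ → EuclideanSpace ℝ (Fin 2) := fun t => x + t • (y - x)
  have hγc : Continuous γ := by fun_prop
  have hγ : ∀ t ∈ Icc (0:ℝ) 1, γ t ∈ S := by
    intro t ht
    exact hS.add_smul_sub_mem hx hy ht
  have hγd : ∀ s t, γ s - γ t = (s - t) • (y - x) := by
    intro s t; simp only [γ, sub_smul]; abel
  have hcont : ContinuousOn (fun t => v (γ t)) (Icc 0 1) :=
    h.hc.comp hγc.continuousOn fun t ht => hSU (hγ t ht)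
  have key := image_le_of_liminf_slope_right_le_deriv_boundary
    (f := fun t => ‖v (γ t) - v x‖) (a := 0) (b := 1)
    (B := fun t => t * (C * ‖y - x‖)) (B' := fun _ => C * ‖y - x‖)
    ((hcont.sub continuousOn_const).norm) (by simp [γ]) (by fun_prop)
    (fun t _ => by simpa using ((hasDerivAt_id t).mul_const (C * ‖y - x‖)).hasDerivWithinAt)
    (by
      intro t ht r hr
      apply Eventually.frequently
      have hU : γ t ∈ U := hSU (hγ t (Ico_subset_Icc_self ht))
      have hev : ∀ᶠ s in nhds t, γ s ∈ nb U V (γ t) :=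
        hγc.continuousAt.eventually ((h.isOpen_nb _).mem_nhds (mem_nb hU))
      filter_upwards [nhdsWithin_le_nhds hev, self_mem_nhdsWithin] with s hs hst
      have hst' : 0 < s - t := sub_pos.2 hst
      have h1 := h.loc_lip hU hs
      rw [hγd, norm_smul, Real.norm_eq_abs, abs_of_pos hst'] at h1
      rw [slope_def_field]
      refine lt_of_le_of_lt ?_ hr
      rw [div_le_iff₀ hst']
      have h2 : ‖v (γ s) - v x‖ - ‖v (γ t) - v x‖ ≤ ‖v (γ s) - v (γ t)‖ := by
        have := norm_sub_norm_le (v (γ s) - v x) (v (γ t) - v x)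
        simpa using this
      calc _ ≤ _ := h2
        _ ≤ _ := h1
        _ = _ := by ring)
    (x := 1) (by simp)
  simpa [γ] using key

lemma hasFDerivAt_piece (h : PAData v U N V L c) {i : Fin N} {x : EuclideanSpace ℝ (Fin 2)}
    (hx : x ∈ V i) : HasFDerivAt v (L i) x := by
  have h1 : HasFDerivAt (fun x => L i x + c i) (L i) x := (L i).hasFDerivAt.add_const _
  refine h1.congr_of_eventuallyEq ?_
  filter_upwards [(h.ho i).mem_nhds hx] with y hy
  exact h.ha i y hy

lemma clarke (h : PAData v U N V L c) (x : EuclideanSpace ℝ (Fin 2)) :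
    convexHull ℝ {A | ∃ i, A = L i ∧ x ∈ closure (V i)} ⊆ clarkeSubdiff v x := by
  apply convexHull_mono
  rintro A ⟨i, rfl, hi⟩
  obtain ⟨u, hu, hux⟩ := mem_closure_iff_seq_limit.1 hi
  refine ⟨u, hux, fun k => (h.hasFDerivAt_piece (hu k)).differentiableAt, ?_⟩
  have : (fun k => fderiv ℝ v (u k)) = fun _ => L i :=
    funext fun k => (h.hasFDerivAt_piece (hu k)).fderiv
  rw [this]
  exact tendsto_const_nhds

/-- zero extension -/
def w (v : EuclideanSpace ℝ (Fin 2) → Fin 3 → ℝ) (U : Set (EuclideanSpace ℝ (Fin 2))) :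
    EuclideanSpace ℝ (Fin 2) → Fin 3 → ℝ := U.indicator v

lemma w_eq {x : EuclideanSpace ℝ (Fin 2)} (hx : x ∈ U) : w v U x = v x := indicator_of_mem hx v

lemma aesm (h : PAData v U N V L c) : AEStronglyMeasurable (w v U) volume :=
  (aestronglyMeasurable_indicator_iff h.hU.measurableSet).2
    (h.hc.aestronglyMeasurable h.hU.measurableSet)

lemma bdd (h : PAData v U N V L c) : ∃ C : ℝ, 0 ≤ C ∧ ∀ x, ‖w v U x‖ ≤ C := by
  obtain ⟨R, hR⟩ := h.hb.exists_norm_le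
  have hR0 : ∀ x ∈ U, ‖x‖ ≤ |R| := fun x hx => (hR x hx).trans (le_abs_self _)
  have h0 : 0 ≤ ∑ i, (‖L i‖ * |R| + ‖c i‖) := Finset.sum_nonneg fun i _ => by positivity
  refine ⟨∑ i, (‖L i‖ * |R| + ‖c i‖), h0, fun x => ?_⟩
  by_cases hx : x ∈ U
  · obtain ⟨i, hi⟩ := h.exists_mem hx
    rw [w_eq hx, h.val hx hi]
    have h1 : ‖L i x + c i‖ ≤ ‖L i‖ * |R| + ‖c i‖ := by
      refine (norm_add_le _ _).trans ?_
      gcongr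
      exact ((L i).le_opNorm x).trans (by gcongr; exact hR0 x hx)
    exact h1.trans (Finset.single_le_sum (f := fun i => ‖L i‖ * |R| + ‖c i‖)
      (fun i _ => by positivity) (Finset.mem_univ i))
  · rw [w, indicator_of_notMem hx]; simpa using h0

lemma locInt (h : PAData v U N V L c) : LocallyIntegrable (w v U) volume := by
  obtain ⟨C, h0, hC⟩ := h.bdd
  intro x
  refine ⟨Metric.ball x 1, Metric.ball_mem_nhds _ one_pos, ?_⟩
  exact Measure.integrableOn_of_bounded (M := C) measure_ball_lt_top.ne h.aesm
    (Eventually.of_forall hC)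

lemma ae_piece (h : PAData v U N V L c) : ∀ᵐ x, x ∈ U → ∃ i, x ∈ V i := by
  have := measure_eq_zero_iff_ae_notMem.1 h.hn
  filter_upwards [this] with x hx hxU
  by_contra hcon
  exact hx ⟨hxU, by simpa using hcon⟩

lemma conv_deriv (h : PAData v U N V L c) (φ : ContDiffBump (0 : EuclideanSpace ℝ (Fin 2)))
    {δ : ℝ} (hδ : 0 < δ) (hφ : φ.rOut = δ / 2) {y : EuclideanSpace ℝ (Fin 2)}
    (hy : Metric.ball y δ ⊆ U) :
    ∃ D ∈ convexHull ℝ {A | ∃ i, A = L i ∧ (V i ∩ Metric.ball y δ).Nonempty},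
      HasFDerivAt (convolution (φ.normed volume) (w v U) (ContinuousLinearMap.lsmul ℝ ℝ) volume)
        D y := by
  set C := ∑ i, ‖L i‖ with hCdef
  have hC : 0 ≤ C := Finset.sum_nonneg fun i _ => norm_nonneg _
  have hex := (φ.hasCompactSupport_normed (μ := volume)).convolutionExists_left
    (μ := volume) (ContinuousLinearMap.lsmul ℝ ℝ : ℝ →L[ℝ] (Fin 3 → ℝ) →L[ℝ] (Fin 3 → ℝ)) φ.continuous_normed h.locInt
  have hzero : ∀ t, ¬ ‖t‖ < δ / 2 → φ.normed volume t = 0 := by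
    intro t ht
    by_contra hne
    have : t ∈ Function.support (φ.normed volume) := hne
    rw [φ.support_normed_eq, hφ] at this
    exact ht (by simpa using this)
  have hin : ∀ x ∈ Metric.ball y (δ / 2), ∀ t : EuclideanSpace ℝ (Fin 2), ‖t‖ < δ / 2 →
      x - t ∈ Metric.ball y δ := by
    intro x hx t ht
    rw [Metric.mem_ball, dist_eq_norm] at hx ⊢
    have := norm_sub_le (x - y) t
    rw [show x - t - y = x - y - t by abel]
    linarith
  have haeV : ∀ᵐ t, y - t ∈ U → ∃ i, y - t ∈ V i :=
    (Measure.measurePreserving_sub_left volume y).quasiMeasurePreserving.ae h.ae_piece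
  have hwd : ∀ i, ∀ x ∈ V i, HasFDerivAt (w v U) (L i) x := by
    intro i x hx
    refine (h.hasFDerivAt_piece hx).congr_of_eventuallyEq ?_
    filter_upwards [h.hU.mem_nhds (h.hs i hx)] with z hz
    exact w_eq hz
  have hym : y ∈ Metric.ball y (δ / 2) := Metric.mem_ball_self (by linarith)
  obtain ⟨hint, hder⟩ := hasFDerivAt_integral_of_dominated_loc_of_lip (𝕜 := ℝ) (μ := volume)
    (F := fun x t => φ.normed volume t • w v U (x - t))
    (F' := fun t => φ.normed volume t • fderiv ℝ (w v U) (y - t))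
    (x₀ := y) (s := Metric.ball y (δ / 2)) (bound := fun t => φ.normed volume t * C)
    (Metric.ball_mem_nhds _ (by linarith))
    (Eventually.of_forall fun x => (hex x).aestronglyMeasurable)
    (hex y)
    (by
      refine φ.continuous_normed.aestronglyMeasurable.smul ?_
      exact ((measurable_fderiv ℝ (w v U)).comp (measurable_const.sub measurable_id)).aestronglyMeasurable)
    (by
      refine Eventually.of_forall fun t => ?_
      by_cases ht : ‖t‖ < δ / 2
      · apply LipschitzOnWith.of_dist_le_mul
        intro a ha b hb
        rw [dist_eq_norm, ← smul_sub, norm_smul, Real.coe_nnabs, abs_mul, abs_of_nonneg hC,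
          Real.norm_eq_abs, mul_assoc, dist_eq_norm]
        have hla := h.lip (convex_ball y δ) hy (hin b hb t ht) (hin a ha t ht)
        rw [w_eq (hy (hin a ha t ht)), w_eq (hy (hin b hb t ht))]
        gcongr
        simpa using hla
      · simp only [hzero t ht, zero_smul]
        exact (LipschitzWith.const _).lipschitzOnWith.weaken (zero_le))
    (φ.integrable_normed.mul_const C)
    (by
      filter_upwards [haeV] with t ht'
      by_cases ht : ‖t‖ < δ / 2
      · obtain ⟨i, hi⟩ := ht' (hy (hin y hym t ht))
        have h1 := hwd i _ hi
        rw [h1.fderiv]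
        have h2 : HasFDerivAt (fun x => w v U (x - t)) (L i) y := by
          have h3 := HasFDerivAt.comp y h1 ((hasFDerivAt_id y).sub_const t)
          simpa using h3
        exact h2.const_smul (φ.normed volume t)
      · simp only [hzero t ht, zero_smul]
        exact hasFDerivAt_const _ _)
  refine ⟨_, ?_, hder⟩
  let f : EuclideanSpace ℝ (Fin 2) → NNReal := fun t => (φ.normed volume t).toNNReal
  have hfm : Measurable f := φ.continuous_normed.measurable.real_toNNReal
  have hfs : (fun t => φ.normed volume t • fderiv ℝ (w v U) (y - t)) =
      fun t => f t • fderiv ℝ (w v U) (y - t) := by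
    funext t
    rw [NNReal.smul_def, Real.coe_toNNReal _ (φ.nonneg_normed t)]
  rw [hfs] at hint ⊢
  rw [← integral_withDensity_eq_integral_smul hfm]
  replace hint := (integrable_withDensity_iff_integrable_smul hfm).2 hint
  have : IsProbabilityMeasure (volume.withDensity fun t => (f t : ℝ≥0∞)) := by
    constructor
    rw [withDensity_apply _ MeasurableSet.univ, Measure.restrict_univ]
    have := ofReal_integral_eq_lintegral_ofReal (φ.integrable_normed (μ := volume))
      (Eventually.of_forall fun t => φ.nonneg_normed t)
    rw [φ.integral_normed] at this
    rw [ENNReal.ofReal_one] at this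
    exact this.symm
  refine (convex_convexHull ℝ _).integral_mem ?_ ?_ hint
  · refine (Set.Finite.isCompact_convexHull ℝ ?_).isClosed
    refine (Set.finite_range L).subset ?_
    rintro A ⟨i, rfl, _⟩
    exact ⟨i, rfl⟩
  · rw [ae_withDensity_iff (by fun_prop)]
    filter_upwards [haeV] with t ht' hne
    have ht : ‖t‖ < δ / 2 := by
      by_contra hcon
      exact hne (by simp [f, hzero t hcon])
    have hb := hin y hym t ht
    obtain ⟨i, hi⟩ := ht' (hy hb)
    rw [(hwd i _ hi).fderiv]
    exact subset_convexHull ℝ _ ⟨i, rfl, ⟨_, hi, hb⟩⟩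

end PAData

section matrixlemmas
open scoped Matrix.Norms.Frobenius

lemma mnorm_eq {k l : ℕ} (A : Matrix (Fin k) (Fin l) ℝ) : mnorm A = ‖A‖ := by
  rw [Matrix.frobenius_norm_def, mnorm, Real.sqrt_eq_rpow]
  simp

lemma mnorm_nonneg {k l : ℕ} (A : Matrix (Fin k) (Fin l) ℝ) : 0 ≤ mnorm A := Real.sqrt_nonneg _

lemma mnorm_add_le {k l : ℕ} (A B : Matrix (Fin k) (Fin l) ℝ) : mnorm (A + B) ≤ mnorm A + mnorm B := by
  simp only [mnorm_eq]; exact norm_add_le _ _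

lemma mnorm_sub_le {k l : ℕ} (A B : Matrix (Fin k) (Fin l) ℝ) : mnorm (A - B) ≤ mnorm A + mnorm B := by
  simp only [mnorm_eq]; exact norm_sub_le _ _

lemma mnorm_smul {k l : ℕ} (t : ℝ) (A : Matrix (Fin k) (Fin l) ℝ) : mnorm (t • A) = |t| * mnorm A := by
  simp only [mnorm_eq]; rw [norm_smul, Real.norm_eq_abs]

lemma mnorm_mul_le {k l m : ℕ} (A : Matrix (Fin k) (Fin l) ℝ) (B : Matrix (Fin l) (Fin m) ℝ) :
    mnorm (A * B) ≤ mnorm A * mnorm B := by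
  simp only [mnorm_eq]; exact Matrix.frobenius_norm_mul _ _

end matrixlemmas

lemma mnorm_convexOn : ConvexOn ℝ univ
    (fun A : EuclideanSpace ℝ (Fin 2) →L[ℝ] (Fin 3 → ℝ) => mnorm (clmMat A)) := by
  refine ⟨convex_univ, ?_⟩
  intro A _ B _ a b ha hb _
  have : clmMat (a • A + b • B) = a • clmMat A + b • clmMat B := by
    ext i j; simp [clmMat]
  simp only [this, smul_eq_mul]
  refine (mnorm_add_le _ _).trans ?_
  rw [mnorm_smul, mnorm_smul, abs_of_nonneg ha, abs_of_nonneg hb]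

lemma continuous_mnorm : Continuous (fun A : EuclideanSpace ℝ (Fin 2) →L[ℝ] (Fin 3 → ℝ) =>
    mnorm (clmMat A)) := by
  simp only [mnorm, clmMat, Matrix.of_apply]
  refine Real.continuous_sqrt.comp ?_
  refine continuous_finsetSum _ fun i _ => continuous_finsetSum _ fun j _ => ?_
  refine Continuous.pow ?_ 2
  have : Continuous fun A : EuclideanSpace ℝ (Fin 2) →L[ℝ] (Fin 3 → ℝ) =>
      A (EuclideanSpace.single j 1) := by fun_prop
  exact (continuous_apply i).comp this

/-- matrix of an endomorphism of the plane -/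
def endMat (A : EuclideanSpace ℝ (Fin 2) →L[ℝ] EuclideanSpace ℝ (Fin 2)) :
    Matrix (Fin 2) (Fin 2) ℝ := Matrix.of fun i j => A (EuclideanSpace.single j 1) i

lemma clmMat_comp (B : EuclideanSpace ℝ (Fin 2) →L[ℝ] (Fin 3 → ℝ))
    (Y : EuclideanSpace ℝ (Fin 2) →L[ℝ] EuclideanSpace ℝ (Fin 2)) (ε : ℝ) :
    clmMat (B.comp (ContinuousLinearMap.id ℝ _ + ε • Y)) = clmMat B * (1 + ε • endMat Y) := by
  ext i j
  have hz : ∀ z : EuclideanSpace ℝ (Fin 2), B z i = ∑ k, z k * B (EuclideanSpace.single k 1) i := by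
    intro z
    have h1 : z = ∑ k, z k • EuclideanSpace.single k (1:ℝ) := by
      ext l; fin_cases l <;> simp
    conv_lhs => rw [h1]
    simp [map_smul]
  simp only [clmMat, Matrix.of_apply, ContinuousLinearMap.comp_apply, Matrix.mul_apply]
  rw [hz]
  refine Finset.sum_congr rfl fun k _ => ?_
  fin_cases k <;> fin_cases j <;> simp [endMat, mul_comm]

lemma endMat_bound (Y : EuclideanSpace ℝ (Fin 2) →L[ℝ] EuclideanSpace ℝ (Fin 2)) (i j : Fin 2) :
    |endMat Y i j| ≤ ‖Y‖ := by
  have h1 := PiLp.norm_apply_le (Y (EuclideanSpace.single j 1)) i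
  have h2 := Y.le_opNorm (EuclideanSpace.single j 1)
  simp at h2
  exact (by simpa [endMat] using h1 : |endMat Y i j| ≤ _).trans h2

lemma mnorm_endMat (Y : EuclideanSpace ℝ (Fin 2) →L[ℝ] EuclideanSpace ℝ (Fin 2)) :
    mnorm (endMat Y) ≤ 2 * ‖Y‖ := by
  rw [mnorm, Real.sqrt_le_left (by positivity)]
  have h : ∀ i j, endMat Y i j ^ 2 ≤ ‖Y‖ ^ 2 := fun i j => by
    rw [← sq_abs]; gcongr; exact endMat_bound Y i j
  simp only [Fin.sum_univ_two]
  have := h 0 0; have := h 0 1; have := h 1 0; have := h 1 1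
  nlinarith

lemma det_pert (Y : EuclideanSpace ℝ (Fin 2) →L[ℝ] EuclideanSpace ℝ (Fin 2)) {ε : ℝ} (hε : 0 ≤ ε)
    (h : ε * ‖Y‖ ≤ 1 / 8) : 1 / 2 ≤ (1 + ε • endMat Y).det := by
  have hb : ∀ i j, |ε * endMat Y i j| ≤ 1 / 8 := fun i j => by
    rw [abs_mul, abs_of_nonneg hε]
    exact (mul_le_mul_of_nonneg_left (endMat_bound Y i j) hε).trans h
  rw [Matrix.det_fin_two]
  simp
  have h1 := abs_le.1 (hb 0 0); have h2 := abs_le.1 (hb 0 1)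
  have h3 := abs_le.1 (hb 1 0); have h4 := abs_le.1 (hb 1 1)
  have h5 : |(ε * endMat Y 0 1) * (ε * endMat Y 1 0)| ≤ 1/8 * (1/8) := by
    rw [abs_mul]; exact mul_le_mul (hb _ _) (hb _ _) (abs_nonneg _) (by norm_num)
  have h6 := abs_le.1 h5
  nlinarith

lemma mnorm_pert (A : Matrix (Fin 3) (Fin 2) ℝ)
    (Y : EuclideanSpace ℝ (Fin 2) →L[ℝ] EuclideanSpace ℝ (Fin 2)) {ε : ℝ} (hε : 0 ≤ ε)
    (h : ε * ‖Y‖ ≤ 1 / 8) : mnorm (A * (1 + ε • endMat Y)) ≤ 2 * mnorm A := by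
  rw [Matrix.mul_add, Matrix.mul_one, Matrix.mul_smul]
  refine (mnorm_add_le _ _).trans ?_
  rw [mnorm_smul, abs_of_nonneg hε]
  have h1 := mnorm_mul_le A (endMat Y)
  have h2 := mnorm_endMat Y
  have h3 := mnorm_nonneg A
  have h4 : ε * mnorm (A * endMat Y) ≤ ε * (mnorm A * (2 * ‖Y‖)) := by gcongr; exact h1.trans (by gcongr)
  nlinarith

lemma cross_eq (A : Matrix (Fin 3) (Fin 2) ℝ) :
    vnorm (cross3 (fun i => A i 0) (fun i => A i 1)) = Real.sqrt (A.transpose * A).det := by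
  rw [vnorm]
  congr 1
  rw [Matrix.det_fin_two]
  simp [Matrix.mul_apply, Fin.sum_univ_three, cross3]
  ring

lemma det_pert_gram (A : Matrix (Fin 3) (Fin 2) ℝ) (M : Matrix (Fin 2) (Fin 2) ℝ) {η : ℝ}
    (hη : 0 < η) (hA : η ≤ (A.transpose * A).det) (hM : 1 / 2 ≤ M.det) :
    Real.sqrt (η / 4) ≤ Real.sqrt ((A * M).transpose * (A * M)).det := by
  apply Real.sqrt_le_sqrt
  have : (A * M).transpose * (A * M) = M.transpose * ((A.transpose * A) * M) := by
    rw [Matrix.transpose_mul]; simp only [Matrix.mul_assoc]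
  rw [this, Matrix.det_mul, Matrix.det_mul, Matrix.det_transpose]
  have h1 : 1/4 ≤ M.det * M.det := by nlinarith
  nlinarith

lemma vnorm_le {k : ℕ} (x : Fin k → ℝ) : vnorm x ≤ k * ‖x‖ := by
  rw [vnorm, Real.sqrt_le_left (by positivity)]
  have h : ∀ i, x i ^ 2 ≤ ‖x‖ ^ 2 := fun i => by
    rw [← sq_abs]; gcongr; exact norm_le_pi_norm x i
  calc ∑ i, x i ^ 2 ≤ ∑ _i : Fin k, ‖x‖ ^ 2 := Finset.sum_le_sum fun i _ => h i
    _ = k * ‖x‖ ^ 2 := by simp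
    _ ≤ (k * ‖x‖) ^ 2 := by
      have : (k:ℝ) ≤ k ^ 2 := by
        rcases Nat.eq_zero_or_pos k with rfl | hk
        · simp
        · have : (1:ℝ) ≤ k := by exact_mod_cast hk
          nlinarith
      rw [mul_pow]; gcongr

lemma continuous_vnorm {k : ℕ} : Continuous (vnorm (k := k)) := by
  unfold vnorm; fun_prop

/-- C¹ approximation of maps in Aff*(U, ℝ³) on a bounded Lipschitz domain
U ⊂ ℝ², with uniform gradient bound and a uniform lower bound θ on |∂₁v_j ∧ ∂₂v_j|. -/
theorem stmt17 (p : ℝ) (hp : 1 ≤ p)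
    (U : Set (EuclideanSpace ℝ (Fin 2))) (hUb : Bornology.IsBounded U)
    (hUl : IsLipschitzGraphDomain (m := 1) U)
    (v : EuclideanSpace ℝ (Fin 2) → Fin 3 → ℝ)
    -- v ∈ Aff*(U, ℝ³)
    (hv : PiecewiseAffineOn v U)
    (hv' : ∃ η > (0:ℝ), ∀ x ∈ U, ∀ A ∈ clarkeSubdiff v x,
      η ≤ ((clmMat A).transpose * clmMat A).det) :
    ∃ (vj : ℕ → EuclideanSpace ℝ (Fin 2) → Fin 3 → ℝ) (θ : ℝ), 0 < θ ∧
      -- v_j ∈ C¹(cl U, ℝ³)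
      (∀ j, ∃ Uj, IsOpen Uj ∧ closure U ⊆ Uj ∧ ContDiffOn ℝ 1 (vj j) Uj) ∧
      -- (i) W^{1,p} convergence
      Tendsto (fun j => ∫⁻ x in U, ENNReal.ofReal (vnorm (vj j x - v x) ^ p))
        atTop (nhds 0) ∧
      Tendsto (fun j => ∫⁻ x in U, ENNReal.ofReal (mnorm (jacMat (vj j) x - jacMat v x) ^ p))
        atTop (nhds 0) ∧
      -- (i) uniform gradient bound ‖∇v_j‖_∞ ≤ 2‖∇v‖_∞
      (∀ j, essSup (fun x => ENNReal.ofReal (mnorm (jacMat (vj j) x))) (volume.restrict U) ≤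
        2 * essSup (fun x => ENNReal.ofReal (mnorm (jacMat v x))) (volume.restrict U)) ∧
      -- (ii) uniform lower bound on |∂₁v_j ∧ ∂₂v_j| on cl U
      (∀ j, ∀ x ∈ closure U,
        θ ≤ vnorm (cross3 (fun i => jacMat (vj j) x i 0) (fun i => jacMat (vj j) x i 1))) := by
  classical
  obtain ⟨η, hη, hcl⟩ := hv'
  obtain ⟨hc, N, V, ho, hs, hd, hn, ha⟩ := hv
  choose L c ha using ha
  have h : PAData v U N V L c := ⟨hUl.1, hUb, hc, ho, hs, hd, hn, ha⟩
  obtain ⟨X, ε₀, hX, hXc, hε₀, hXin⟩ := aux_field U hUb hUl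
  obtain ⟨CX, hCX⟩ := (hX.continuous_fderiv one_ne_zero).bounded_above_of_compact_support
    (hXc.fderiv (𝕜 := ℝ))
  have hCX0 : 0 ≤ CX := (norm_nonneg _).trans (hCX 0)
  set ε₁ : ℝ := min ε₀ (1 / (8 * (CX + 1))) with hε₁
  have hε₁0 : 0 < ε₁ := lt_min hε₀ (by positivity)
  let ε : ℕ → ℝ := fun j => ε₁ * (1 / ((j:ℝ) + 1))
  have hε0 : ∀ j, 0 < ε j := fun j => by positivity
  have hε1 : ∀ j, ε j ≤ ε₁ := fun j => by
    have : 1 / ((j:ℝ) + 1) ≤ 1 := by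
      rw [div_le_one (by positivity)]; linarith [(Nat.cast_nonneg j : (0:ℝ) ≤ j)]
    exact mul_le_of_le_one_right hε₁0.le this
  have hεlim : Tendsto ε atTop (nhds 0) := by
    simpa [ε] using (tendsto_one_div_add_atTop_nhds_zero_nat (𝕜 := ℝ)).const_mul ε₁
  have hεY : ∀ j x, ε j * ‖fderiv ℝ X x‖ ≤ 1 / 8 := by
    intro j x
    have h1 : ε j ≤ 1 / (8 * (CX + 1)) := (hε1 j).trans (min_le_right _ _)
    have h2 : ‖fderiv ℝ X x‖ ≤ CX + 1 := (hCX x).trans (by linarith)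
    calc ε j * ‖fderiv ℝ X x‖ ≤ 1 / (8 * (CX + 1)) * (CX + 1) := by
          gcongr
      _ = 1 / 8 := by field_simp
  let Φ : ℕ → EuclideanSpace ℝ (Fin 2) → EuclideanSpace ℝ (Fin 2) := fun j x => x + ε j • X x
  have hΦd : ∀ j, ContDiff ℝ 1 (Φ j) := fun j => contDiff_id.add (hX.const_smul (ε j))
  have hΦU : ∀ j, ∀ x ∈ closure U, Φ j x ∈ U := fun j x hx =>
    hXin (ε j) (hε0 j) ((hε1 j).trans (min_le_left _ _)) x hx
  have hΦlim : ∀ x, Tendsto (fun j => Φ j x) atTop (nhds x) := by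
    intro x
    simpa using (hεlim.smul_const (X x)).const_add x
  have hcU : IsCompact (closure U) := hUb.isCompact_closure
  have hδ : ∀ j : ℕ, ∃ δ : ℝ, 0 < δ ∧ δ ≤ 1 / ((j:ℝ) + 1) ∧ ∀ x ∈ closure U,
      ∃ z ∈ U, Metric.ball (Φ j x) δ ⊆ PAData.nb U V z := by
    intro j
    obtain ⟨δ, hδ, hδ'⟩ := lebesgue_number_lemma_of_metric
      (hcU.image (hΦd j).continuous) (c := fun z : U => PAData.nb U V z.1)
      (fun z => h.isOpen_nb _) (by
        rintro _ ⟨x, hx, rfl⟩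
        exact mem_iUnion.2 ⟨⟨Φ j x, hΦU j x hx⟩, PAData.mem_nb (hΦU j x hx)⟩)
    refine ⟨min δ (1 / ((j:ℝ) + 1)), lt_min hδ (by positivity), min_le_right _ _, ?_⟩
    intro x hx
    obtain ⟨z, hz⟩ := hδ' _ (mem_image_of_mem _ hx)
    exact ⟨z.1, z.2, (Metric.ball_subset_ball (min_le_left _ _)).trans hz⟩
  choose δ hδ0 hδ1 hδnb using hδ
  have hδlim : Tendsto δ atTop (nhds 0) :=
    squeeze_zero (fun j => (hδ0 j).le) hδ1 (tendsto_one_div_add_atTop_nhds_zero_nat (𝕜 := ℝ))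
  let φ : ℕ → ContDiffBump (0 : EuclideanSpace ℝ (Fin 2)) := fun j =>
    ⟨δ j / 4, δ j / 2, by linarith [hδ0 j], by linarith [hδ0 j]⟩
  let g : ℕ → EuclideanSpace ℝ (Fin 2) → Fin 3 → ℝ := fun j =>
    convolution ((φ j).normed volume) (PAData.w v U) (ContinuousLinearMap.lsmul ℝ ℝ) volume
  have hgd : ∀ j, ContDiff ℝ 1 (g j) := fun j =>
    ((φ j).hasCompactSupport_normed (μ := volume)).contDiff_convolution_left (n := 1)
      (μ := volume) (ContinuousLinearMap.lsmul ℝ ℝ : ℝ →L[ℝ] (Fin 3 → ℝ) →L[ℝ] (Fin 3 → ℝ))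
      ((φ j).contDiff_normed) h.locInt
  have hD : ∀ j, ∀ x ∈ closure U, ∃ D ∈ convexHull ℝ
      {A | ∃ i, A = L i ∧ (V i ∩ Metric.ball (Φ j x) (δ j)).Nonempty},
      HasFDerivAt (g j) D (Φ j x) := by
    intro j x hx
    obtain ⟨z, hz, hzb⟩ := hδnb j x hx
    exact h.conv_deriv (φ j) (hδ0 j) rfl (fun y hy => (hzb hy).1)
  choose! D hDc hDd using hD
  have hjac : ∀ j, ∀ x ∈ closure U, jacMat (fun x => g j (Φ j x)) x =
      clmMat (D j x) * (1 + ε j • endMat (fderiv ℝ X x)) := by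
    intro j x hx
    have hΦ' : HasFDerivAt (Φ j) (ContinuousLinearMap.id ℝ _ + ε j • fderiv ℝ X x) x :=
      (hasFDerivAt_id x).add ((hX.differentiable one_ne_zero x).hasFDerivAt.const_smul (ε j))
    have h1 : HasFDerivAt (fun x => g j (Φ j x))
        ((D j x).comp (ContinuousLinearMap.id ℝ _ + ε j • fderiv ℝ X x)) x :=
      (hDd j x hx).comp x hΦ'
    rw [jacMat, h1.fderiv, clmMat_comp]
  have hmn : ∀ j, ∀ x ∈ closure U, ∃ i, (V i).Nonempty ∧
      mnorm (jacMat (fun x => g j (Φ j x)) x) ≤ 2 * mnorm (clmMat (L i)) := by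
    intro j x hx
    obtain ⟨A, ⟨i, rfl, hi⟩, hA⟩ := mnorm_convexOn.exists_ge_of_mem_convexHull (subset_univ _)
      (hDc j x hx)
    refine ⟨i, hi.mono inter_subset_left, ?_⟩
    rw [hjac j x hx]
    refine (mnorm_pert _ _ (hε0 j).le (hεY j x)).trans ?_
    linarith
  have hae : ∀ᵐ x ∂(volume.restrict U), x ∈ U ∧ ∃ i, x ∈ V i := by
    filter_upwards [ae_restrict_mem hUl.1.measurableSet, ae_restrict_of_ae h.ae_piece] with x hx hx'
    exact ⟨hx, hx' hx⟩
  have hfin : volume U ≠ ⊤ := hUb.measure_lt_top.ne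
  have hp0 : 0 < p := by linarith
  refine ⟨fun j x => g j (Φ j x), Real.sqrt (η / 4), by positivity, ?_, ?_, ?_, ?_, ?_⟩
  · intro j
    exact ⟨univ, isOpen_univ, subset_univ _, ((hgd j).comp (hΦd j)).contDiffOn⟩
  · obtain ⟨C, hC0, hC⟩ := h.bdd
    have := tendsto_lintegral_of_dominated_convergence' (μ := volume.restrict U)
      (F := fun j x => ENNReal.ofReal (vnorm (g j (Φ j x) - v x) ^ p)) (f := fun _ => 0)
      (fun _ => ENNReal.ofReal ((3 * (4 * C)) ^ p)) ?_ ?_ ?_ ?_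
    · simpa using this
    · intro j
      have h1 : AEMeasurable (fun x => g j (Φ j x) - v x) (volume.restrict U) :=
        ((hgd j).continuous.comp (hΦd j).continuous).aemeasurable.sub
          (hc.aemeasurable hUl.1.measurableSet)
      exact ((continuous_vnorm.measurable.comp_aemeasurable h1).pow_const p).ennreal_ofReal
    · intro j
      filter_upwards [hae] with x hx
      apply ENNReal.ofReal_le_ofReal
      refine Real.rpow_le_rpow (Real.sqrt_nonneg _) ?_ hp0.le
      refine (vnorm_le _).trans ?_
      have h1 : dist (g j (Φ j x)) (PAData.w v U (Φ j x)) ≤ 2 * C := by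
        apply ContDiffBump.dist_normed_convolution_le h.aesm
        intro z _
        rw [dist_eq_norm]
        exact (norm_sub_le _ _).trans (by linarith [hC z, hC (Φ j x)])
      rw [dist_eq_norm] at h1
      have h2 : ‖g j (Φ j x) - v x‖ ≤ 4 * C := by
        rw [← PAData.w_eq (v := v) hx.1]
        have e : g j (Φ j x) - PAData.w v U x = (g j (Φ j x) - PAData.w v U (Φ j x)) +
          (PAData.w v U (Φ j x) - PAData.w v U x) := by abel
        rw [e]
        refine (norm_add_le _ _).trans ?_
        have := norm_sub_le (PAData.w v U (Φ j x)) (PAData.w v U x)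
        linarith [hC x, hC (Φ j x)]
      push_cast
      gcongr
    · simp only [lintegral_const, Measure.restrict_apply_univ]
      exact ENNReal.mul_ne_top ENNReal.ofReal_ne_top hfin
    · filter_upwards [hae] with x hx
      have hcw : Tendsto (PAData.w v U) (nhds x) (nhds (v x)) := by
        have h1 := (hc.continuousAt (hUl.1.mem_nhds hx.1)).tendsto
        refine h1.congr' ?_
        filter_upwards [hUl.1.mem_nhds hx.1] with z hz
        exact (PAData.w_eq hz).symm
      have h1 : Tendsto (fun j => g j (Φ j x)) atTop (nhds (v x)) := by
        refine ContDiffBump.convolution_tendsto_right (φ := φ) (g := fun _ => PAData.w v U)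
          (k := fun j => Φ j x) (x₀ := x) ?_ (Eventually.of_forall fun _ => h.aesm) ?_ (hΦlim x)
        · simpa [φ] using hδlim.div_const 2
        · exact hcw.comp tendsto_snd
      have h2 : Tendsto (fun j => vnorm (g j (Φ j x) - v x)) atTop (nhds 0) := by
        have := (continuous_vnorm.tendsto _).comp (h1.sub_const (v x))
        simpa [vnorm, Function.comp_def] using this
      have h3 := ENNReal.tendsto_ofReal (h2.rpow_const (p := p) (Or.inr hp0.le))
      simpa [Real.zero_rpow hp0.ne'] using h3
  · set M := ∑ i, mnorm (clmMat (L i)) with hM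
    have hLM : ∀ i, mnorm (clmMat (L i)) ≤ M := fun i =>
      Finset.single_le_sum (f := fun i => mnorm (clmMat (L i))) (fun i _ => mnorm_nonneg _)
        (Finset.mem_univ i)
    have hjv : ∀ i, ∀ x ∈ V i, jacMat v x = clmMat (L i) := fun i x hx => by
      rw [jacMat, (h.hasFDerivAt_piece hx).fderiv]
    have := tendsto_lintegral_of_dominated_convergence' (μ := volume.restrict U)
      (F := fun j x => ENNReal.ofReal (mnorm (jacMat (fun x => g j (Φ j x)) x - jacMat v x) ^ p))
      (f := fun _ => 0) (fun _ => ENNReal.ofReal ((3 * M) ^ p)) ?_ ?_ ?_ ?_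
    · simpa using this
    · intro j
      have h1 : Measurable (fun x => fderiv ℝ (fun x => g j (Φ j x)) x - fderiv ℝ v x) :=
        (measurable_fderiv ℝ _).sub (measurable_fderiv ℝ _)
      have h2 := continuous_mnorm.measurable.comp h1
      exact (h2.pow_const p).ennreal_ofReal.aemeasurable
    · intro j
      filter_upwards [hae] with x hx
      obtain ⟨hxU, i, hi⟩ := hx
      apply ENNReal.ofReal_le_ofReal
      refine Real.rpow_le_rpow (Real.sqrt_nonneg _) ?_ hp0.le
      refine (mnorm_sub_le _ _).trans ?_
      obtain ⟨k, -, hk⟩ := hmn j x (subset_closure hxU)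
      rw [hjv i x hi]
      linarith [hLM i, hLM k]
    · simp only [lintegral_const, Measure.restrict_apply_univ]
      exact ENNReal.mul_ne_top ENNReal.ofReal_ne_top hfin
    · filter_upwards [hae] with x hx
      obtain ⟨hxU, i, hi⟩ := hx
      obtain ⟨r, hr, hrV⟩ := Metric.isOpen_iff.1 (ho i) x hi
      have hev : ∀ᶠ j in atTop, D j x = L i := by
        have e1 : ∀ᶠ j in atTop, Φ j x ∈ Metric.ball x (r / 2) :=
          (hΦlim x).eventually (Metric.ball_mem_nhds _ (by linarith))
        have e2 : ∀ᶠ j in atTop, δ j < r / 2 := hδlim.eventually (gt_mem_nhds (by linarith))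
        filter_upwards [e1, e2] with j h1 h2
        have hsub : Metric.ball (Φ j x) (δ j) ⊆ V i := by
          refine (Metric.ball_subset_ball' ?_).trans hrV
          rw [Metric.mem_ball] at h1
          linarith
        have hsub2 : {A | ∃ k, A = L k ∧ (V k ∩ Metric.ball (Φ j x) (δ j)).Nonempty} ⊆ {L i} := by
          rintro A ⟨k, rfl, y, hy, hy'⟩
          by_cases hki : k = i
          · rw [hki]; rfl
          · exact absurd (hsub hy') (Set.disjoint_left.1 (hd k i hki) hy)
        have := convexHull_mono (𝕜 := ℝ) hsub2 (hDc j x (subset_closure hxU))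
        simpa using this
      have hM2 : Tendsto (fun j => ε j * mnorm (clmMat (L i) * endMat (fderiv ℝ X x))) atTop
          (nhds 0) := by simpa using hεlim.mul_const (mnorm (clmMat (L i) * endMat (fderiv ℝ X x)))
      have h3 := ENNReal.tendsto_ofReal (hM2.rpow_const (p := p) (Or.inr hp0.le))
      rw [Real.zero_rpow hp0.ne', ENNReal.ofReal_zero] at h3
      refine h3.congr' ?_
      filter_upwards [hev] with j hj
      rw [hjac j x (subset_closure hxU), hj, hjv i x hi, Matrix.mul_add, Matrix.mul_one,
        add_sub_cancel_left, Matrix.mul_smul, mnorm_smul, abs_of_pos (hε0 j)]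
  · intro j
    refine essSup_le_of_ae_le _ ?_
    filter_upwards [hae] with x hx
    obtain ⟨k, hkne, hk⟩ := hmn j x (subset_closure hx.1)
    have hk' : ENNReal.ofReal (mnorm (clmMat (L k))) ≤
        essSup (fun x => ENNReal.ofReal (mnorm (jacMat v x))) (volume.restrict U) := by
      have hle := ENNReal.ae_le_essSup (μ := volume.restrict U)
        (fun x => ENNReal.ofReal (mnorm (jacMat v x)))
      have hle' := ae_restrict_of_ae_restrict_of_subset (hs k) hle
      have hne : (ae (volume.restrict (V k))).NeBot := by
        rw [ae_neBot, Ne, Measure.restrict_eq_zero]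
        exact ((ho k).measure_pos volume hkne).ne'
      obtain ⟨y, hy1, hy2⟩ := (hle'.and (ae_restrict_mem (ho k).measurableSet)).exists
      rwa [jacMat, (h.hasFDerivAt_piece hy2).fderiv] at hy1
    calc ENNReal.ofReal (mnorm (jacMat (fun x => g j (Φ j x)) x))
        ≤ ENNReal.ofReal (2 * mnorm (clmMat (L k))) := ENNReal.ofReal_le_ofReal hk
      _ = 2 * ENNReal.ofReal (mnorm (clmMat (L k))) := by
          rw [ENNReal.ofReal_mul (by norm_num)]; norm_num
      _ ≤ _ := by gcongr
  · intro j x hx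
    rw [cross_eq, hjac j x hx]
    refine det_pert_gram _ _ hη ?_ (det_pert _ (hε0 j).le (hεY j x))
    obtain ⟨z, hz, hzb⟩ := hδnb j x hx
    refine hcl z hz _ (h.clarke z ?_)
    refine convexHull_mono ?_ (hDc j x hx)
    rintro A ⟨i, rfl, y, hy, hy'⟩
    exact ⟨i, rfl, (hzb hy').2 i (subset_closure hy)⟩
end
end
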